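/- arXiv:0902.3429 — 2 statements merged into one kernel-verified Lean document; each statement's English description precedes it below -/
import Mathlib

section
/- Let n ≥ 1 and let H be a discrete group of bijective isometries of the euclidean space ℝⁿ. Then H contains no nontrivial translation if and only if for every α > 0 there exists x ∈ ℝⁿ such that ‖xh − x‖ > α for every h ∈ H ∖ {Id}. (Theorem 4.4) -/
open Set Metric

namespace Paper

/-- A group `H` of bijective isometries of `E` is discrete if for each `x` there is `η > 0`
such that the orbit of `x` meets the closed ball `β(x,η)` only in `x`. -/
def DiscreteIsomGroup {E : Type*} [MetricSpace E] (H : Subgroup (E ≃ᵢ E)) : Prop :=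
  ∀ x : E, ∃ η : ℝ, 0 < η ∧
    ((fun h : E ≃ᵢ E => h x) '' (H : Set (E ≃ᵢ E))) ∩ closedBall x η = {x}

theorem norm_inv_apply_zero {E : Type*} [NormedAddCommGroup E] (h : E ≃ᵢ E) : ‖h⁻¹ 0‖ = ‖h 0‖ := by
  have := h.dist_eq (h⁻¹ 0) 0
  rw [IsometryEquiv.apply_inv_self, dist_zero_right, dist_zero_left] at this
  exact this.symm

section Isometries

variable {E : Type*} [NormedAddCommGroup E] [InnerProductSpace ℝ E]

/-- The linear part of a bijective isometry, as a continuous linear map. -/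
noncomputable def linearPart : (E ≃ᵢ E) →* (E →L[ℝ] E) where
  toFun h := (h.toRealLinearIsometryEquiv : E →L[ℝ] E)
  map_one' := by
    ext x
    simp [IsometryEquiv.toRealLinearIsometryEquiv_apply]
  map_mul' g h := by
    ext x
    have key := (g.toRealLinearIsometryEquiv).map_sub (h x) (h 0)
    simp only [IsometryEquiv.toRealLinearIsometryEquiv_apply] at key
    simp [IsometryEquiv.toRealLinearIsometryEquiv_apply, IsometryEquiv.mul_apply, key]

theorem linearPart_apply (h : E ≃ᵢ E) (x : E) : linearPart h x = h x - h 0 := by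
  simp [linearPart, IsometryEquiv.toRealLinearIsometryEquiv_apply]

theorem linearPart_sub (h : E ≃ᵢ E) (x y : E) : linearPart h (x - y) = h x - h y := by
  rw [map_sub, linearPart_apply, linearPart_apply, sub_sub_sub_cancel_right]

theorem apply_add (h : E ≃ᵢ E) (x v : E) : h (x + v) = h x + linearPart h v := by
  have := linearPart_sub h (x + v) x
  rw [add_sub_cancel_left] at this
  rw [this, add_sub_cancel]

theorem norm_linearPart_apply (h : E ≃ᵢ E) (x : E) : ‖linearPart h x‖ = ‖x‖ := by
  rw [linearPart_apply, ← dist_eq_norm, h.dist_eq, dist_zero_right]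

theorem inner_linearPart (h : E ≃ᵢ E) (x y : E) :
    inner ℝ (linearPart h x) (linearPart h y) = inner ℝ x y :=
  h.toRealLinearIsometryEquiv.inner_map_map x y

theorem norm_linearPart_le (h : E ≃ᵢ E) : ‖linearPart h‖ ≤ 1 :=
  ContinuousLinearMap.opNorm_le_bound _ zero_le_one fun x => by
    rw [norm_linearPart_apply, one_mul]

theorem norm_linearPart_mul (h : E ≃ᵢ E) (T : E →L[ℝ] E) : ‖linearPart h * T‖ ≤ ‖T‖ :=
  (norm_mul_le _ _).trans (mul_le_of_le_one_left (norm_nonneg _) (norm_linearPart_le h))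

theorem norm_mul_linearPart (h : E ≃ᵢ E) (T : E →L[ℝ] E) : ‖T * linearPart h‖ ≤ ‖T‖ :=
  (norm_mul_le _ _).trans (mul_le_of_le_one_right (norm_nonneg _) (norm_linearPart_le h))

theorem linearPart_mul_inv (h : E ≃ᵢ E) : linearPart h * linearPart h⁻¹ = 1 := by
  rw [← map_mul, mul_inv_cancel, map_one]

theorem linearPart_inv_mul (h : E ≃ᵢ E) : linearPart h⁻¹ * linearPart h = 1 := by
  rw [← map_mul, inv_mul_cancel, map_one]

theorem norm_linearPart_conj_sub_one_le (g h : E ≃ᵢ E) :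
    ‖linearPart (g * h * g⁻¹) - 1‖ ≤ ‖linearPart h - 1‖ := by
  have : linearPart (g * h * g⁻¹) - 1 = linearPart g * ((linearPart h - 1) * linearPart g⁻¹) := by
    rw [map_mul, map_mul, sub_mul, mul_sub, one_mul, linearPart_mul_inv, mul_assoc]
  rw [this]
  exact (norm_linearPart_mul _ _).trans (norm_mul_linearPart _ _)

theorem norm_linearPart_inv_sub_one_le (h : E ≃ᵢ E) :
    ‖linearPart h⁻¹ - 1‖ ≤ ‖linearPart h - 1‖ := by
  have : linearPart h⁻¹ - 1 = -(linearPart h⁻¹ * (linearPart h - 1)) := by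
    rw [mul_sub, linearPart_inv_mul, mul_one, neg_sub]
  rw [this, norm_neg]
  exact norm_linearPart_mul _ _

theorem norm_commutator_linearPart_le (g h : E ≃ᵢ E) :
    ‖linearPart g * linearPart h - linearPart h * linearPart g‖
      ≤ 2 * ‖linearPart g - 1‖ * ‖linearPart h - 1‖ := by
  have : linearPart g * linearPart h - linearPart h * linearPart g
      = (linearPart g - 1) * (linearPart h - 1) - (linearPart h - 1) * (linearPart g - 1) := by
    noncomm_ring
  rw [this]
  refine (norm_sub_le _ _).trans ?_
  have h₁ := norm_mul_le (linearPart g - 1) (linearPart h - 1)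
  have h₂ := norm_mul_le (linearPart h - 1) (linearPart g - 1)
  linarith

open scoped commutatorElement

theorem norm_linearPart_commutator_sub_one_le (g h : E ≃ᵢ E) :
    ‖linearPart ⁅g, h⁆ - 1‖ ≤ 2 * ‖linearPart g - 1‖ * ‖linearPart h - 1‖ := by
  have : linearPart ⁅g, h⁆ - 1
      = (linearPart g * linearPart h - linearPart h * linearPart g) * linearPart (g⁻¹ * h⁻¹) := by
    rw [sub_mul, ← map_mul, ← map_mul, ← map_mul, ← map_mul, commutatorElement_def]
    simp [mul_assoc]
  rw [this]
  exact (norm_mul_linearPart _ _).trans (norm_commutator_linearPart_le g h)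

theorem norm_commutator_apply_zero_le (g h : E ≃ᵢ E) :
    ‖⁅g, h⁆ 0‖ ≤ ‖linearPart g - 1‖ * ‖h 0‖ + ‖linearPart h - 1‖ * ‖g 0‖
      + 2 * ‖linearPart g - 1‖ * ‖linearPart h - 1‖ * (‖g 0‖ + ‖h 0‖) := by
  set y := (h * g)⁻¹ 0 with hy
  have hy0 : h (g y) = 0 := (h * g).apply_inv_self 0
  have hyn : ‖y‖ ≤ ‖g 0‖ + ‖h 0‖ := by
    rw [hy, norm_inv_apply_zero, IsometryEquiv.mul_apply]
    have := linearPart_apply h (g 0)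
    calc ‖h (g 0)‖ = ‖linearPart h (g 0) + h 0‖ := by rw [this, sub_add_cancel]
      _ ≤ _ := (norm_add_le _ _).trans_eq (by rw [norm_linearPart_apply])
  have hc : ⁅g, h⁆ 0 = g (h y) := by
    rw [hy, commutatorElement_def, mul_inv_rev, mul_assoc]
    rfl
  have hexp : ∀ a b : E ≃ᵢ E,
      a (b y) = (linearPart a * linearPart b) y + linearPart a (b 0) + a 0 := by
    intro a b
    have h₁ := linearPart_apply a (b y)
    have h₂ := linearPart_apply b y
    rw [mul_apply_eq_comp, h₂, map_sub, h₁]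
    abel
  have : ⁅g, h⁆ 0 = (linearPart g - 1) (h 0) - (linearPart h - 1) (g 0)
      + (linearPart g * linearPart h - linearPart h * linearPart g) y := by
    have e : ⁅g, h⁆ 0 = g (h y) - h (g y) := by rw [hy0, sub_zero, hc]
    rw [e, hexp, hexp]
    simp only [sub_apply, one_apply_eq_self]
    abel
  rw [this]
  refine (norm_add_le _ _).trans (add_le_add ((norm_sub_le _ _).trans
    (add_le_add (ContinuousLinearMap.le_opNorm _ _) (ContinuousLinearMap.le_opNorm _ _))) ?_)
  refine (ContinuousLinearMap.le_opNorm _ _).trans ?_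
  gcongr
  exact norm_commutator_linearPart_le g h

/-- The isometry group has no small subgroups, as far as linear parts are concerned. -/
theorem linearPart_eq_one_of_pow_small {c : E ≃ᵢ E}
    (hc : ∀ j : ℕ, ‖linearPart (c ^ j) - 1‖ ≤ 1 / 4) : linearPart c = 1 := by
  have grow : ∀ j : ℕ, (3 / 2 : ℝ) ^ j * ‖linearPart c - 1‖ ≤ ‖linearPart (c ^ 2 ^ j) - 1‖ := by
    intro j
    induction j with
    | zero => simp
    | succ j ih =>
      have hs := hc (2 ^ j)
      set C := linearPart (c ^ 2 ^ j)
      have hC : linearPart (c ^ 2 ^ (j + 1)) = C * C := by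
        rw [← map_mul, ← pow_add, ← two_mul, pow_succ']
      have e : (2 : ℝ) • (C - 1) = (C * C - 1) - (C - 1) * (C - 1) := by
        rw [two_smul]; noncomm_ring
      have h₁ : 2 * ‖C - 1‖ ≤ ‖C * C - 1‖ + ‖C - 1‖ * ‖C - 1‖ := by
        calc 2 * ‖C - 1‖ = ‖(2 : ℝ) • (C - 1)‖ := by rw [norm_smul]; norm_num
          _ ≤ _ := by
            rw [e]
            exact (norm_sub_le _ _).trans (add_le_add le_rfl (norm_mul_le _ _))
      rw [hC, pow_succ]
      nlinarith [norm_nonneg (C - 1)]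
  by_contra hne
  have hpos : 0 < ‖linearPart c - 1‖ := norm_pos_iff.mpr (sub_ne_zero.mpr hne)
  obtain ⟨j, hj⟩ := pow_unbounded_of_one_lt (1 / ‖linearPart c - 1‖)
    (by norm_num : (1 : ℝ) < 3 / 2)
  rw [div_lt_iff₀ hpos] at hj
  linarith [grow j, hc (2 ^ j)]

theorem linearPart_commutator_eq_one {g h : E ≃ᵢ E} (hh : ‖linearPart h - 1‖ ≤ 1 / 8)
    (hc : Commute g ⁅g, h⁆) : linearPart ⁅g, h⁆ = 1 := by
  refine linearPart_eq_one_of_pow_small fun j => ?_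
  have hconj : ∀ j : ℕ, g ^ j * h * (g ^ j)⁻¹ = ⁅g, h⁆ ^ j * h := by
    intro j
    induction j with
    | zero => simp
    | succ j ih =>
      calc g ^ (j + 1) * h * (g ^ (j + 1))⁻¹ = g * (g ^ j * h * (g ^ j)⁻¹) * g⁻¹ := by
            rw [pow_succ', mul_inv_rev]; simp only [mul_assoc]
        _ = ⁅g, h⁆ ^ j * (g * h * g⁻¹) := by
            rw [ih, ← mul_assoc g, (hc.pow_right j).eq]; simp only [mul_assoc]
        _ = ⁅g, h⁆ ^ (j + 1) * h := by
            rw [pow_succ, commutatorElement_def]; simp [mul_assoc]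
  have hj : ⁅g, h⁆ ^ j = g ^ j * h * (g ^ j)⁻¹ * h⁻¹ := by rw [hconj, mul_inv_cancel_right]
  have e : linearPart (⁅g, h⁆ ^ j) - 1
      = (linearPart (g ^ j * h * (g ^ j)⁻¹) - 1) * linearPart h⁻¹ + (linearPart h⁻¹ - 1) := by
    rw [hj, map_mul, sub_mul, one_mul, sub_add_sub_cancel]
  rw [e]
  refine (norm_add_le _ _).trans ?_
  have h₁ := (norm_mul_linearPart h⁻¹ _).trans (norm_linearPart_conj_sub_one_le (g ^ j) h)
  have h₂ := norm_linearPart_inv_sub_one_le h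
  linarith

theorem linearPart_fixed_of_fixed_sub {g : E ≃ᵢ E} {z : E}
    (hz : linearPart g (linearPart g z - z) = linearPart g z - z) : linearPart g z = z := by
  set y := linearPart g z - z with hy
  have h₁ := inner_linearPart g y z
  have h₂ : linearPart g z = z + y := by rw [hy, add_sub_cancel]
  rw [hz, h₂, inner_add_right, add_eq_left, inner_self_eq_zero] at h₁
  rw [h₂, h₁, add_zero]

/-- The vectors fixed by the linear parts of all elements of `S`. -/
def fixedDirections (S : Set (E ≃ᵢ E)) : Submodule ℝ E where
  carrier := {v | ∀ g ∈ S, linearPart g v = v}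
  add_mem' hv hw g hg := by rw [map_add, hv g hg, hw g hg]
  zero_mem' g _ := map_zero _
  smul_mem' c v hv g hg := by rw [map_smul, hv g hg]

/-- The intersection of the minimal displacement sets of the elements of `S`. -/
def commonMinSet (S : Set (E ≃ᵢ E)) : Set E :=
  {x | ∀ g ∈ S, linearPart g (g x - x) = g x - x}

theorem sub_mem_fixedDirections {S : Set (E ≃ᵢ E)} {x y : E}
    (hx : x ∈ commonMinSet S) (hy : y ∈ commonMinSet S) : x - y ∈ fixedDirections S := by
  intro g hg
  apply linearPart_fixed_of_fixed_sub
  have : linearPart g (x - y) - (x - y) = (g x - x) - (g y - y) := by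
    rw [linearPart_sub]; abel
  rw [this, map_sub, hx g hg, hy g hg]

theorem add_mem_commonMinSet {S : Set (E ≃ᵢ E)} {x v : E}
    (hx : x ∈ commonMinSet S) (hv : v ∈ fixedDirections S) : x + v ∈ commonMinSet S := by
  intro g hg
  have : g (x + v) - (x + v) = g x - x := by
    rw [apply_add, hv g hg, add_sub_add_right_eq_sub]
  rw [this, hx g hg]

section Normalizer

variable {S : Set (E ≃ᵢ E)} {h : E ≃ᵢ E}

theorem apply_mem_commonMinSet (hS : ∀ g ∈ S, h⁻¹ * g * h ∈ S) {x : E}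
    (hx : x ∈ commonMinSet S) : h x ∈ commonMinSet S := by
  intro g hg
  have e : g * h = h * (h⁻¹ * g * h) := by group
  have e₁ : g (h x) - h x = linearPart h ((h⁻¹ * g * h) x - x) := by
    rw [linearPart_sub, ← IsometryEquiv.mul_apply, e, IsometryEquiv.mul_apply]
  rw [e₁, ← mul_apply_eq_comp, ← map_mul, e, map_mul, mul_apply_eq_comp,
    hx _ (hS g hg)]

theorem linearPart_mem_fixedDirections (hS : ∀ g ∈ S, h⁻¹ * g * h ∈ S) {v : E}
    (hv : v ∈ fixedDirections S) : linearPart h v ∈ fixedDirections S := by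
  intro g hg
  have e : g * h = h * (h⁻¹ * g * h) := by group
  rw [← mul_apply_eq_comp, ← map_mul, e, map_mul, mul_apply_eq_comp,
    hv _ (hS g hg)]

theorem linearPart_mem_fixedDirections_orthogonal (hS : ∀ g ∈ S, h * g * h⁻¹ ∈ S) {w : E}
    (hw : w ∈ (fixedDirections S)ᗮ) : linearPart h w ∈ (fixedDirections S)ᗮ := by
  rw [Submodule.mem_orthogonal]
  intro v hv
  have hv' : linearPart h⁻¹ v ∈ fixedDirections S :=
    linearPart_mem_fixedDirections (by simpa using hS) hv
  have e : v = linearPart h (linearPart h⁻¹ v) := by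
    rw [← mul_apply_eq_comp, linearPart_mul_inv, one_apply_eq_self]
  rw [e, inner_linearPart]
  exact Submodule.inner_right_of_mem_orthogonal hv' hw

end Normalizer

variable [FiniteDimensional ℝ E]

theorem commonMinSet_nonempty_of_invariant {S : Set (E ≃ᵢ E)}
    (hS : ∀ g ∈ S, ∀ h ∈ S, Commute g h) (D : Submodule ℝ E) :
    ∀ x : E, (∀ g ∈ S, ∀ v ∈ D, linearPart g v ∈ D) → (∀ g ∈ S, g x - x ∈ D) →
      (commonMinSet S).Nonempty := by
  induction D using WellFoundedLT.induction with
  | ind D ih =>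
  intro x hD hx
  by_cases hfix : ∀ g ∈ S, ∀ v ∈ D, linearPart g v = v
  · exact ⟨x, fun g hg => hfix g hg _ (hx g hg)⟩
  push Not at hfix
  obtain ⟨g, hg, v, hv, hgv⟩ := hfix
  let L : E →ₗ[ℝ] E := ((linearPart g - 1 : E →L[ℝ] E) : E →ₗ[ℝ] E)
  have hL : ∀ u, L u = linearPart g u - u := fun u => rfl
  obtain ⟨p, ⟨u, hu, rfl⟩, q, hq, hpq⟩ := (D.map L).exists_add_mem_mem_orthogonal (g x - x)
  have hqD : q ∈ D := by
    have : q = (g x - x) - L u := by rw [hpq, add_sub_cancel_left]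
    rw [this]
    exact D.sub_mem (hx g hg) (D.sub_mem (hD g hg u hu) hu)
  have hgq : linearPart g q = q := by
    have h₁ : inner ℝ (linearPart g q - q) q = 0 :=
      Submodule.inner_right_of_mem_orthogonal (Submodule.mem_map_of_mem hqD) hq
    have h₂ := norm_sub_sq_real (linearPart g q) q
    rw [inner_sub_left, real_inner_self_eq_norm_sq] at h₁
    rw [norm_linearPart_apply] at h₂
    have h₃ : ‖linearPart g q - q‖ ^ 2 = 0 := by rw [h₂]; linarith
    exact sub_eq_zero.mp (norm_eq_zero.mp (by simpa using h₃))
  have hmove : g (x - u) - (x - u) = q := by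
    have h₁ := apply_add g x (-u)
    rw [map_neg, ← sub_eq_add_neg, ← sub_eq_add_neg] at h₁
    rw [h₁, ← sub_eq_zero, ← sub_eq_zero.mpr hpq, hL]
    abel
  have hcomm : ∀ h ∈ S, ∀ w, linearPart g (linearPart h w) = linearPart h (linearPart g w) := by
    intro h hh w
    rw [← mul_apply_eq_comp, ← mul_apply_eq_comp, ← map_mul, ← map_mul,
      (hS g hg h hh).eq]
  refine ih (D ⊓ LinearMap.ker L) ?_ (x - u) ?_ ?_
  · refine lt_of_le_of_ne inf_le_left fun heq => hgv ?_
    have : v ∈ LinearMap.ker L := (heq.symm.le hv).2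
    exact sub_eq_zero.mp this
  · rintro h hh w ⟨hw, hw'⟩
    refine ⟨hD h hh w hw, ?_⟩
    have hw'' : linearPart g w = w := sub_eq_zero.mp hw'
    rw [SetLike.mem_coe, LinearMap.mem_ker, hL, hcomm h hh, hw'', sub_self]
  · intro h hh
    refine ⟨?_, ?_⟩
    · have : h (x - u) - (x - u) = (h x - x) - (linearPart h u - u) := by
        have h₁ := apply_add h x (-u)
        rw [map_neg, ← sub_eq_add_neg, ← sub_eq_add_neg] at h₁
        rw [h₁]
        abel
      rw [this]
      exact D.sub_mem (hx h hh) (D.sub_mem (hD h hh u hu) hu)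
    · refine sub_eq_zero.mpr ?_
      apply linearPart_fixed_of_fixed_sub
      have : linearPart g (h (x - u) - (x - u)) - (h (x - u) - (x - u)) = linearPart h q - q := by
        have hgh : g (h (x - u)) = h (g (x - u)) := DFunLike.congr_fun (hS g hg h hh).eq (x - u)
        rw [linearPart_sub, hgh, ← hmove, linearPart_sub]
        abel
      rw [this, map_sub, hcomm h hh, hgq]

theorem commonMinSet_nonempty {S : Set (E ≃ᵢ E)} (hS : ∀ g ∈ S, ∀ h ∈ S, Commute g h) :
    (commonMinSet S).Nonempty :=
  commonMinSet_nonempty_of_invariant hS ⊤ 0 (fun _ _ _ _ => trivial) fun _ _ => trivial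

end Isometries

theorem finite_of_isBounded_of_separated {X : Type*} [PseudoMetricSpace X] [ProperSpace X]
    {s : Set X} (hs : Bornology.IsBounded s) {ε : ℝ} (hε : 0 < ε)
    (hsep : ∀ x ∈ s, ∀ y ∈ s, dist x y < ε → x = y) : s.Finite := by
  obtain ⟨t, ht, hst⟩ := Metric.totallyBounded_iff.mp
    (hs.isCompact_closure.totallyBounded.subset subset_closure) (ε / 2) (half_pos hε)
  have : s ⊆ ⋃ y ∈ t, s ∩ ball y (ε / 2) := by
    intro x hx
    obtain ⟨y, hy, hxy⟩ := mem_iUnion₂.mp (hst hx)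
    exact mem_iUnion₂.mpr ⟨y, hy, hx, hxy⟩
  refine (ht.biUnion fun y _ => Set.Subsingleton.finite ?_).subset this
  rintro a ⟨ha, ha'⟩ b ⟨hb, hb'⟩
  refine hsep a ha b hb ((dist_triangle_right a b y).trans_lt ?_)
  rw [mem_ball] at ha' hb'
  linarith

theorem exists_forall_lt_norm_add {V E ι : Type*} [AddCommGroup V] [Module ℝ V]
    [NormedAddCommGroup E] [NormedSpace ℝ E] [Finite ι] (c : ι → E) (L : ι → V →ₗ[ℝ] E)
    (hL : ∀ i, L i ≠ 0) (α : ℝ) : ∃ v, ∀ i, α < ‖c i + L i v‖ := by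
  obtain ⟨v, hv⟩ := Submodule.exists_forall_notMem_of_forall_ne_top (fun i => LinearMap.ker (L i))
    fun i => by simpa [LinearMap.ker_eq_top] using hL i
  have hev : ∀ i, ∀ᶠ t : ℝ in Filter.atTop, α < ‖c i + L i (t • v)‖ := by
    intro i
    have hpos : 0 < ‖L i v‖ := norm_pos_iff.mpr (hv i)
    filter_upwards [Filter.eventually_gt_atTop ((α + ‖c i‖) / ‖L i v‖)] with t ht
    rw [div_lt_iff₀ hpos] at ht
    have h₁ : t * ‖L i v‖ ≤ ‖t • L i v‖ := by
      rw [norm_smul]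
      exact mul_le_mul_of_nonneg_right (le_abs_self t) hpos.le
    have h₂ := norm_le_add_norm_add (t • L i v) (c i)
    rw [map_smul, add_comm]
    linarith
  obtain ⟨t, ht⟩ := (Filter.eventually_all.mpr hev).exists
  exact ⟨t • v, ht⟩

section Discrete

variable {E : Type*} [NormedAddCommGroup E] [InnerProductSpace ℝ E] {H : Subgroup (E ≃ᵢ E)}

/-- The elements of `H` whose linear part is close to the identity. -/
def smallRotations (H : Subgroup (E ≃ᵢ E)) : Set (E ≃ᵢ E) :=
  {h | h ∈ H ∧ ‖linearPart h - 1‖ ≤ 1 / 8}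

theorem conj_mem_smallRotations {h g : E ≃ᵢ E} (hh : h ∈ H) (hg : g ∈ smallRotations H) :
    h * g * h⁻¹ ∈ smallRotations H :=
  ⟨H.mul_mem (H.mul_mem hh hg.1) (H.inv_mem hh),
    (norm_linearPart_conj_sub_one_le h g).trans hg.2⟩

variable [FiniteDimensional ℝ E]

theorem DiscreteIsomGroup.finite_orbit (hdisc : DiscreteIsomGroup H) (x y : E) (r : ℝ) :
    (((fun h : E ≃ᵢ E => h x) '' (H : Set (E ≃ᵢ E))) ∩ closedBall y r).Finite := by
  obtain ⟨η, hη, hx⟩ := hdisc x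
  refine finite_of_isBounded_of_separated (isBounded_closedBall.subset inter_subset_right) hη ?_
  rintro _ ⟨⟨g, hg, rfl⟩, -⟩ _ ⟨⟨h, hh, rfl⟩, -⟩ hgh
  have hmem : (h⁻¹ * g) x ∈ ((fun h : E ≃ᵢ E => h x) '' (H : Set (E ≃ᵢ E))) ∩ closedBall x η := by
    refine ⟨⟨_, H.mul_mem (H.inv_mem hh) hg, rfl⟩, ?_⟩
    rw [mem_closedBall, ← h.dist_eq, IsometryEquiv.mul_apply, IsometryEquiv.apply_inv_self]
    exact hgh.le
  rw [hx, mem_singleton_iff] at hmem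
  have := congrArg h hmem
  rwa [IsometryEquiv.mul_apply, IsometryEquiv.apply_inv_self] at this

theorem DiscreteIsomGroup.finite_dist_le (hdisc : DiscreteIsomGroup H) (x : E) (r : ℝ) :
    {h | h ∈ H ∧ dist (h x) x ≤ r}.Finite := by
  let b := Module.finBasis ℝ E
  let p : Option (Fin (Module.finrank ℝ E)) → E := fun o => o.elim 0 b
  have hinj : Function.Injective fun (h : E ≃ᵢ E) i => h (p i) := by
    intro g h hgh
    have h0 : g 0 = h 0 := congrFun hgh none
    have hlin : (linearPart g : E →ₗ[ℝ] E) = linearPart h := by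
      refine b.ext fun i => ?_
      have hi : g (b i) = h (b i) := congrFun hgh (some i)
      simp only [ContinuousLinearMap.coe_coe, linearPart_apply, hi, h0]
    ext y
    have hy := DFunLike.congr_fun hlin y
    simpa only [ContinuousLinearMap.coe_coe, linearPart_apply, h0, sub_left_inj] using hy
  refine Set.Finite.of_finite_image ((Set.Finite.pi fun i =>
    hdisc.finite_orbit (p i) x (dist (p i) x + r)).subset ?_) hinj.injOn
  rintro _ ⟨h, ⟨hh, hr⟩, rfl⟩ i -
  refine ⟨⟨h, hh, rfl⟩, ?_⟩
  rw [mem_closedBall]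
  calc dist (h (p i)) x ≤ dist (h (p i)) (h x) + dist (h x) x := dist_triangle _ _ _
    _ ≤ _ := by rw [h.dist_eq]; gcongr

open scoped commutatorElement in
theorem DiscreteIsomGroup.commute_of_smallRotations (hdisc : DiscreteIsomGroup H)
    (hlin : ∀ h ∈ H, linearPart h = 1 → h = 1) {g h : E ≃ᵢ E}
    (hg : g ∈ smallRotations H) (hh : h ∈ smallRotations H) : Commute g h := by
  rw [commute_iff_eq, ← commutatorElement_eq_one_iff_mul_comm]
  let u : (E ≃ᵢ E) → ℝ := fun k => ‖k 0‖ + (8 * ‖g 0‖ + 1) * ‖linearPart k - 1‖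
  have hu : ∀ k ∈ smallRotations H, u ⁅g, k⁆ ≤ u k / 2 := by
    intro k hk
    have h₁ := norm_linearPart_commutator_sub_one_le g k
    have h₂ := norm_commutator_apply_zero_le g k
    have hg' := hg.2
    have hk' := hk.2
    change ‖_‖ + _ * ‖_‖ ≤ (‖_‖ + _ * ‖_‖) / 2
    generalize ‖linearPart ⁅g, k⁆ - 1‖ = x at *
    generalize ‖⁅g, k⁆ 0‖ = y at *
    have a0 := norm_nonneg (linearPart g - 1)
    have b0 := norm_nonneg (linearPart k - 1)
    have c0 := norm_nonneg (g 0)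
    have d0 := norm_nonneg (k 0)
    generalize ‖linearPart g - 1‖ = a at *
    generalize ‖linearPart k - 1‖ = b at *
    generalize ‖g 0‖ = c at *
    generalize ‖k 0‖ = d at *
    have h₃ : x ≤ b / 4 := by nlinarith
    have h₄ : y ≤ d / 4 + 2 * (b * c) := by
      have e₁ : a * d ≤ d / 8 := by nlinarith
      have e₂ : 2 * a * b * (c + d) ≤ b / 4 * (c + d) := by
        apply mul_le_mul_of_nonneg_right _ (by positivity)
        nlinarith
      have e₃ : b * d ≤ d / 8 := by nlinarith
      have e₄ : 0 ≤ b * c := by positivity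
      nlinarith
    have h₅ : (8 * c + 1) * x ≤ (8 * c + 1) * (b / 4) := by gcongr
    nlinarith
  by_contra hne
  let bad := {k | k ∈ smallRotations H ∧ ⁅g, k⁆ ≠ 1 ∧ u k ≤ u h}
  have hfin : bad.Finite := by
    refine (hdisc.finite_dist_le 0 (u h)).subset ?_
    rintro k ⟨hk, -, hku⟩
    refine ⟨hk.1, ?_⟩
    rw [dist_zero_right]
    exact (le_add_of_nonneg_right (by positivity)).trans hku
  obtain ⟨k, ⟨hk, hkne, hku⟩, hmin⟩ := hfin.exists_minimalFor u bad ⟨h, hh, hne, le_rfl⟩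
  have hk1 : k ≠ 1 := by
    rintro rfl
    exact hkne (commutatorElement_one_right g)
  have hupos : 0 < u k := by
    have : 0 < ‖linearPart k - 1‖ :=
      norm_pos_iff.mpr (sub_ne_zero.mpr fun h1 => hk1 (hlin k hk.1 h1))
    change 0 < ‖_‖ + _ * ‖_‖
    positivity
  have hcH : ⁅g, k⁆ ∈ H := by
    rw [commutatorElement_def]
    exact H.mul_mem (H.mul_mem (H.mul_mem hg.1 hk.1) (H.inv_mem hg.1)) (H.inv_mem hk.1)
  have hcS : ⁅g, k⁆ ∈ smallRotations H := by
    refine ⟨hcH, (norm_linearPart_commutator_sub_one_le g k).trans ?_⟩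
    nlinarith [hg.2, hk.2, norm_nonneg (linearPart g - 1), norm_nonneg (linearPart k - 1)]
  have huc := hu k hk
  have hcomm : ⁅g, ⁅g, k⁆⁆ = 1 := by
    by_contra hbad
    have := hmin (j := ⁅g, k⁆) ⟨hcS, hbad, by linarith⟩ (by linarith)
    linarith
  exact hkne (hlin _ hcH (linearPart_commutator_eq_one hk.2
    (commutatorElement_eq_one_iff_mul_comm.mp hcomm)))

theorem finite_of_forall_smallRotations_eq_one {T : Subgroup (E ≃ᵢ E)} (hTH : T ≤ H)
    (hT : ∀ h ∈ T, h ∈ smallRotations H → h = 1) : (T : Set (E ≃ᵢ E)).Finite := by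
  have key : ∀ g ∈ T, ∀ h ∈ T, dist (linearPart g) (linearPart h) < 1 / 8 → g = h := by
    intro g hg h hh hgh
    have hmem := T.mul_mem (T.inv_mem hh) hg
    have : h⁻¹ * g = 1 := by
      refine hT _ hmem ⟨hTH hmem, ?_⟩
      have e : linearPart (h⁻¹ * g) - 1 = linearPart h⁻¹ * (linearPart g - linearPart h) := by
        rw [mul_sub, linearPart_inv_mul, map_mul]
      rw [e]
      rw [dist_eq_norm] at hgh
      exact (norm_linearPart_mul _ _).trans hgh.le
    exact (inv_mul_eq_one.mp this).symm
  refine Set.Finite.of_finite_image (f := linearPart) ?_ fun g hg h hh hgh =>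
    key g hg h hh (by rw [hgh, dist_self]; norm_num)
  refine finite_of_isBounded_of_separated (ε := 1 / 8) ?_ (by norm_num) ?_
  · refine (isBounded_closedBall (x := (0 : E →L[ℝ] E)) (r := 1)).subset ?_
    rintro _ ⟨h, -, rfl⟩
    rw [mem_closedBall, dist_zero_right]
    exact norm_linearPart_le h
  · rintro _ ⟨g, hg, rfl⟩ _ ⟨h, hh, rfl⟩ hgh
    rw [key g hg h hh hgh]

theorem DiscreteIsomGroup.exists_forall_lt_dist (hdisc : DiscreteIsomGroup H)
    (hlin : ∀ h ∈ H, linearPart h = 1 → h = 1) (α : ℝ) :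
    ∃ x : E, ∀ h ∈ H, h ≠ 1 → α < dist (h x) x := by
  set S := smallRotations H
  set F := fixedDirections S
  have hconj : ∀ h ∈ H, ∀ g ∈ S, h * g * h⁻¹ ∈ S := fun h hh g hg => conj_mem_smallRotations hh hg
  have hconj' : ∀ h ∈ H, ∀ g ∈ S, h⁻¹ * g * h ∈ S := fun h hh g hg => by
    simpa using hconj h⁻¹ (H.inv_mem hh) g hg
  obtain ⟨m₀, hm₀⟩ : (commonMinSet S).Nonempty :=
    commonMinSet_nonempty fun g hg h hh => hdisc.commute_of_smallRotations hlin hg hh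
  let T : Subgroup (E ≃ᵢ E) :=
    { carrier := {h | h ∈ H ∧ ∀ w ∈ Fᗮ, linearPart h w = w}
      mul_mem' := fun {a b} ha hb => ⟨H.mul_mem ha.1 hb.1, fun w hw => by
        rw [map_mul, mul_apply_eq_comp, hb.2 w hw, ha.2 w hw]⟩
      one_mem' := ⟨H.one_mem, fun w _ => by rw [map_one, one_apply_eq_self]⟩
      inv_mem' := fun {a} ha => ⟨H.inv_mem ha.1, fun w hw => by
        conv_lhs => rw [← ha.2 w hw, ← mul_apply_eq_comp, linearPart_inv_mul,
          one_apply_eq_self]⟩ }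
  have heq_one : ∀ h ∈ T, (∀ v ∈ F, linearPart h v = v) → h = 1 := by
    intro h hh hv
    refine hlin h hh.1 (ContinuousLinearMap.ext fun x => ?_)
    obtain ⟨y, hy, z, hz, rfl⟩ := F.exists_add_mem_mem_orthogonal x
    rw [map_add, hv y hy, hh.2 z hz, one_apply_eq_self]
  have hTfin : (T : Set (E ≃ᵢ E)).Finite :=
    finite_of_forall_smallRotations_eq_one (fun h hh => hh.1)
      fun h hh hS => heq_one h hh fun v hv => hv h hS
  obtain ⟨v, hv⟩ : ∃ v : F, ∀ h ∈ T, h ≠ 1 → α < ‖(h m₀ - m₀) + (linearPart h v - v)‖ := by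
    have : Finite {h // h ∈ T ∧ h ≠ 1} := (hTfin.subset fun h hh => hh.1 : Set.Finite _).to_subtype
    obtain ⟨v, hv⟩ := exists_forall_lt_norm_add (ι := {h // h ∈ T ∧ h ≠ 1})
      (fun h => h.1 m₀ - m₀)
      (fun h => ((linearPart h.1 - 1 : E →L[ℝ] E) : E →ₗ[ℝ] E) ∘ₗ F.subtype)
      (fun h h0 => h.2.2 (heq_one h.1 h.2.1 fun v hv =>
        sub_eq_zero.mp (LinearMap.congr_fun h0 ⟨v, hv⟩))) α
    exact ⟨v, fun h hh h1 => hv ⟨h, hh, h1⟩⟩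
  obtain ⟨m, hm, hmT⟩ : ∃ m ∈ commonMinSet S, ∀ h ∈ T, h ≠ 1 → α < dist (h m) m := by
    refine ⟨m₀ + v, add_mem_commonMinSet hm₀ v.2, fun h hh h1 => ?_⟩
    rw [apply_add, dist_eq_norm, add_sub_add_comm]
    exact hv h hh h1
  obtain ⟨w, hw⟩ : ∃ w : ↥Fᗮ, ∀ h ∈ H, h ∉ T → dist (h m) m ≤ α → α < ‖linearPart h w - w‖ := by
    have : Finite {h // h ∈ H ∧ h ∉ T ∧ dist (h m) m ≤ α} :=
      ((hdisc.finite_dist_le m α).subset fun h hh => ⟨hh.1, hh.2.2⟩ : Set.Finite _).to_subtype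
    obtain ⟨w, hw⟩ := exists_forall_lt_norm_add (ι := {h // h ∈ H ∧ h ∉ T ∧ dist (h m) m ≤ α})
      (fun _ => (0 : E))
      (fun h => ((linearPart h.1 - 1 : E →L[ℝ] E) : E →ₗ[ℝ] E) ∘ₗ Fᗮ.subtype)
      (fun h h0 => h.2.2.1 ⟨h.2.1, fun v hv =>
        sub_eq_zero.mp (LinearMap.congr_fun h0 ⟨v, hv⟩)⟩) α
    refine ⟨w, fun h hh hT hα => ?_⟩
    simpa using hw ⟨h, hh, hT, hα⟩
  refine ⟨m + w, fun h hh h1 => ?_⟩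
  rw [apply_add, dist_eq_norm, add_sub_add_comm]
  have hpF : h m - m ∈ F :=
    sub_mem_fixedDirections (apply_mem_commonMinSet (hconj' h hh) hm) hm
  have hqF : linearPart h w - w ∈ Fᗮ :=
    Fᗮ.sub_mem (linearPart_mem_fixedDirections_orthogonal (hconj h hh) w.2) w.2
  have hpyth := norm_add_sq_eq_norm_sq_add_norm_sq_real
    (Submodule.inner_right_of_mem_orthogonal hpF hqF)
  have hp : ‖h m - m‖ ≤ ‖(h m - m) + (linearPart h w - w)‖ :=
    le_of_sq_le_sq (by nlinarith [norm_nonneg (linearPart h w - w)]) (norm_nonneg _)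
  have hq : ‖linearPart h w - w‖ ≤ ‖(h m - m) + (linearPart h w - w)‖ :=
    le_of_sq_le_sq (by nlinarith [norm_nonneg (h m - m)]) (norm_nonneg _)
  rcases lt_or_ge α (dist (h m) m) with hα | hα
  · rw [dist_eq_norm] at hα
    exact hα.trans_le hp
  · by_cases hT : h ∈ T
    · exact absurd (hmT h hT h1) hα.not_gt
    · exact (hw h hh hT hα).trans_le hq

end Discrete

/-- **Theorem 4.4.** Let `n ≥ 1` and let `H` be a discrete group of bijective isometries of
the euclidean space `ℝⁿ`. Then `H` contains no nontrivial translation if and only if for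
every `α > 0` there exists `x` such that `‖xh − x‖ > α` for every `h ∈ H ∖ {Id}`. -/
theorem thm_4_4 (n : ℕ) (hn : 1 ≤ n)
    (H : Subgroup (EuclideanSpace ℝ (Fin n) ≃ᵢ EuclideanSpace ℝ (Fin n)))
    (hdisc : DiscreteIsomGroup H) :
    (¬ ∃ h ∈ H, ∃ v : EuclideanSpace ℝ (Fin n), v ≠ 0 ∧ ∀ x, h x = x + v) ↔
      (∀ α : ℝ, 0 < α → ∃ x : EuclideanSpace ℝ (Fin n),
        ∀ h ∈ H, h ≠ 1 → α < dist (h x) x) := by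
  constructor
  · intro htr α _
    refine hdisc.exists_forall_lt_dist (fun h hh hlin => ?_) α
    have happ : ∀ x, h x = x + h 0 := fun x => by
      rw [← sub_eq_iff_eq_add, ← linearPart_apply, hlin, one_apply_eq_self]
    have h0 : h 0 = 0 := by
      by_contra hne
      exact htr ⟨h, hh, h 0, hne, happ⟩
    ext1 x
    rw [happ, h0, add_zero]
    rfl
  · rintro hfar ⟨h, hh, v, hv, hx⟩
    obtain ⟨x, hxα⟩ := hfar ‖v‖ (norm_pos_iff.mpr hv)
    have hne : h ≠ 1 := by
      rintro rfl
      exact hv (left_eq_add.mp (hx 0))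
    have := hxα h hh hne
    rw [hx, dist_eq_norm, add_sub_cancel_left] at this
    exact lt_irrefl _ this

end Paper
end

section
/- Let n ≥ 1 and let 𝒯 be a tiling of the euclidean space ℝⁿ (isomorphism being taken modulo the group G of all bijective isometries of ℝⁿ) which satisfies the local isomorphism property. Then 𝒯 is locally isomorphic to a rigid tiling if and only if 𝒯 is not invariant through a nontrivial translation, i.e. there is no v ∈ ℝⁿ ∖ {0} with 𝒯 + v = 𝒯. (Corollary 4.3) -/
open Set Metric

namespace Paper

variable {E : Type*} [MetricSpace E]

/-- Image of a tile under an isometry (right action of `σ` on tiles). -/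
def tmap (σ : E ≃ᵢ E) (T : Set E) : Set E := σ '' T

/-- Image of a set of tiles under an isometry. -/
def smap (σ : E ≃ᵢ E) (ℰ : Set (Set E)) : Set (Set E) := tmap σ '' ℰ

/-- `bt ℰ T n` is the set `B_n^ℰ(T)` of tiles of `ℰ` at combinatorial distance at most `n`
from `T`. -/
def bt (ℰ : Set (Set E)) (T : Set E) : ℕ → Set (Set E)
  | 0 => {T}
  | n + 1 => {U | U ∈ ℰ ∧ ∃ V ∈ bt ℰ T n, (U ∩ V).Nonempty}

/-- A tile is a closed bounded subset of `E`. -/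
def IsTile (T : Set E) : Prop := IsClosed T ∧ Bornology.IsBounded T

variable (G : Subgroup (E ≃ᵢ E))

/-- `(ℰ,T) ≅ (ℰ',T')` modulo `G`. -/
def PIso (ℰ : Set (Set E)) (T : Set E) (ℰ' : Set (Set E)) (T' : Set E) : Prop :=
  ∃ σ ∈ G, smap σ ℰ = ℰ' ∧ tmap σ T = T'

/-- `(ℰ,T) ≤ (ℰ',T')` modulo `G`. -/
def PLe (ℰ : Set (Set E)) (T : Set E) (ℰ' : Set (Set E)) (T' : Set E) : Prop :=
  ∃ σ ∈ G, smap σ ℰ ⊆ ℰ' ∧ tmap σ T = T'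

/-- The pairs `(B_r^ℰ(T),T)`, `T ∈ ℰ`, fall into finitely many isomorphism classes. -/
def FinClasses (ℰ : Set (Set E)) (r : ℕ) : Prop :=
  ∃ 𝒜 : Set (Set E), 𝒜.Finite ∧ 𝒜 ⊆ ℰ ∧
    ∀ T ∈ ℰ, ∃ S ∈ 𝒜, PIso G (bt ℰ S r) S (bt ℰ T r) T

/-- A tiling of `E` (modulo the group `G`). -/
def IsTiling (𝒯 : Set (Set E)) : Prop :=
  (∀ T ∈ 𝒯, IsTile T) ∧ ⋃₀ 𝒯 = univ ∧
    ∀ r : ℕ, 1 ≤ r →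
      (∀ T ∈ 𝒯, (bt 𝒯 T r).Finite ∧ ⋃₀ (bt 𝒯 T (r - 1)) ⊆ interior (⋃₀ (bt 𝒯 T r))) ∧
      (∀ S ∈ 𝒯, ∀ T ∈ 𝒯, PLe G (bt 𝒯 S r) S (bt 𝒯 T r) T →
        PIso G (bt 𝒯 S r) S (bt 𝒯 T r) T) ∧
      FinClasses G 𝒯 r

/-- A patch. -/
def IsPatch (ℰ : Set (Set E)) : Prop :=
  ∀ S ∈ ℰ, ∀ T ∈ ℰ, ∃ r : ℕ, T ∈ bt ℰ S r

/-- The local isomorphism property for a tiling. -/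
def TilingLIP (𝒯 : Set (Set E)) : Prop :=
  ∀ ℰ ⊆ 𝒯, IsPatch ℰ → ℰ.Finite →
    ∃ k : ℕ, 1 ≤ k ∧ ∀ T ∈ 𝒯, ∃ σ ∈ G, smap σ ℰ ⊆ bt 𝒯 T k

/-- `𝒮 ⋐ 𝒯` for tilings: each finite subpatch of `𝒮` is isomorphic to a subpatch of `𝒯`. -/
def TSub (𝒮 𝒯 : Set (Set E)) : Prop :=
  ∀ ℰ ⊆ 𝒮, IsPatch ℰ → ℰ.Finite →
    ∃ ℱ ⊆ 𝒯, IsPatch ℱ ∧ ∃ σ ∈ G, smap σ ℰ = ℱ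

/-- Locally isomorphic tilings. -/
def TLocIso (𝒮 𝒯 : Set (Set E)) : Prop := TSub G 𝒮 𝒯 ∧ TSub G 𝒯 𝒮

/-- A rigid tiling: no nontrivial element of `G` leaves it globally invariant. -/
def TRigid (𝒯 : Set (Set E)) : Prop := ∀ σ ∈ G, smap σ 𝒯 = 𝒯 → σ = 1

/-- The displacement of an isometry is `2`-Lipschitz. -/
theorem dist_apply_le {X : Type*} [MetricSpace X] (γ : X ≃ᵢ X) (x y : X) :
    dist (γ x) x ≤ dist (γ y) y + 2 * dist x y := by
  have h := dist_triangle4 (γ x) (γ y) y x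
  rw [γ.dist_eq, dist_comm y x] at h
  linarith

theorem dist_mul_inv_apply_le {X : Type*} [MetricSpace X] (γ δ : X ≃ᵢ X) (x : X) :
    dist ((γ * δ⁻¹) x) x ≤ dist (γ x) x + dist (δ x) x := by
  have h1 : dist ((γ * δ⁻¹) x) (γ x) = dist (δ x) x := by
    change dist (γ (δ⁻¹ x)) (γ x) = _
    rw [γ.dist_eq, ← δ.dist_eq, dist_comm]
    congr 1
    exact δ.apply_symm_apply x
  have := dist_triangle ((γ * δ⁻¹) x) (γ x) x
  linarith

section LinearPart

open scoped commutatorElement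

variable {V : Type*} [NormedAddCommGroup V] [InnerProductSpace ℝ V]

/-- The linear part of an isometry of a real inner product space. -/
noncomputable def lin (γ : V ≃ᵢ V) : V →L[ℝ] V :=
  γ.toRealAffineIsometryEquiv.linearIsometryEquiv.toContinuousLinearEquiv.toContinuousLinearMap

theorem lin_sub (γ : V ≃ᵢ V) (x y : V) : lin γ (x - y) = γ x - γ y := by
  have := γ.toRealAffineIsometryEquiv.map_vsub x y
  simpa [lin] using this

theorem lin_apply (γ : V ≃ᵢ V) (x : V) : lin γ x = γ x - γ 0 := by
  simpa using lin_sub γ x 0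

theorem norm_lin_apply (γ : V ≃ᵢ V) (x : V) : ‖lin γ x‖ = ‖x‖ := by
  rw [lin_apply, ← dist_eq_norm, γ.dist_eq, dist_zero_right]

theorem norm_lin_le (γ : V ≃ᵢ V) : ‖lin γ‖ ≤ 1 :=
  ContinuousLinearMap.opNorm_le_bound _ zero_le_one fun x => by rw [norm_lin_apply, one_mul]

theorem lin_mul (γ δ : V ≃ᵢ V) : lin (γ * δ) = lin γ * lin δ := by
  ext x
  rw [mul_apply_eq_comp, lin_apply δ, lin_sub, lin_apply]
  rfl

theorem lin_one : lin (1 : V ≃ᵢ V) = 1 := by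
  ext x
  rw [lin_apply]
  simp

theorem lin_mul_inv (γ : V ≃ᵢ V) : lin γ * lin γ⁻¹ = 1 := by
  rw [← lin_mul, mul_inv_cancel, lin_one]

theorem lin_pow (γ : V ≃ᵢ V) (k : ℕ) : lin (γ ^ k) = lin γ ^ k := by
  induction k with
  | zero => simp [lin_one]
  | succ k ih => rw [pow_succ, pow_succ, lin_mul, ih]

theorem norm_lin_mul_le (γ : V ≃ᵢ V) (X : V →L[ℝ] V) : ‖lin γ * X‖ ≤ ‖X‖ :=
  (norm_mul_le _ _).trans (mul_le_of_le_one_left (norm_nonneg _) (norm_lin_le γ))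

theorem norm_mul_lin_le (γ : V ≃ᵢ V) (X : V →L[ℝ] V) : ‖X * lin γ‖ ≤ ‖X‖ :=
  (norm_mul_le _ _).trans (mul_le_of_le_one_right (norm_nonneg _) (norm_lin_le γ))

theorem norm_lin_conj_sub_one_le (ρ γ : V ≃ᵢ V) :
    ‖lin (ρ * γ * ρ⁻¹) - 1‖ ≤ ‖lin γ - 1‖ := by
  have h : lin (ρ * γ * ρ⁻¹) - 1 = lin ρ * (lin γ - 1) * lin ρ⁻¹ := by
    rw [lin_mul, lin_mul, mul_sub, sub_mul, mul_one, lin_mul_inv]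
  rw [h]
  exact (norm_mul_lin_le _ _).trans (norm_lin_mul_le _ _)

theorem eq_one_of_lin_eq_one {γ : V ≃ᵢ V} (h : lin γ = 1) {x : V} (hx : γ x = x) : γ = 1 := by
  ext y
  have := lin_sub γ y x
  rw [h, hx] at this
  simpa using this.symm

/-- A normed algebra has no small subgroups. -/
theorem eq_one_of_forall_norm_pow_sub_one_le {A : Type*} [NormedRing A] [NormedAlgebra ℝ A]
    {a : A} (h : ∀ k : ℕ, ‖a ^ k - 1‖ ≤ 1 / 4) : a = 1 := by
  have step : ∀ k : ℕ, (7 / 4 : ℝ) ^ k * ‖a - 1‖ ≤ ‖a ^ 2 ^ k - 1‖ := by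
    intro k
    induction k with
    | zero => simp
    | succ k ih =>
      set b := a ^ 2 ^ k with hb
      have e : (2 : ℝ) • (b - 1) = (a ^ 2 ^ (k + 1) - 1) - (b - 1) * (b - 1) := by
        rw [pow_succ 2 k, pow_mul, ← hb, two_smul]
        noncomm_ring
      have h1 : ‖(2 : ℝ) • (b - 1)‖ = 2 * ‖b - 1‖ := by rw [norm_smul]; norm_num
      have h2 := norm_sub_le (a ^ 2 ^ (k + 1) - 1) ((b - 1) * (b - 1))
      rw [← e, h1] at h2
      have h3 := norm_mul_le (b - 1) (b - 1)
      have h4 := h (2 ^ k)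
      rw [← hb] at h4
      rw [pow_succ]
      nlinarith [norm_nonneg (b - 1)]
  by_contra hne
  have hpos : 0 < ‖a - 1‖ := norm_pos_iff.2 (sub_ne_zero.2 hne)
  obtain ⟨k, hk⟩ := pow_unbounded_of_one_lt (1 / ‖a - 1‖) (by norm_num : (1 : ℝ) < 7 / 4)
  rw [div_lt_iff₀ hpos] at hk
  linarith [step k, h (2 ^ k)]

theorem lin_commutator_eq_one {γ δ : V ≃ᵢ V} (hδ : ‖lin δ - 1‖ ≤ 1 / 8)
    (h : lin ⁅γ, δ⁆ * lin γ = lin γ * lin ⁅γ, δ⁆) : lin ⁅γ, δ⁆ = 1 := by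
  have key : ∀ k : ℕ, lin (γ ^ k * δ * (γ ^ k)⁻¹) = lin ⁅γ, δ⁆ ^ k * lin δ := by
    intro k
    induction k with
    | zero => simp
    | succ k ih =>
      have e : γ ^ (k + 1) * δ * (γ ^ (k + 1))⁻¹ = γ * (γ ^ k * δ * (γ ^ k)⁻¹) * γ⁻¹ := by
        rw [pow_succ']; group
      have e2 : γ * δ * γ⁻¹ = ⁅γ, δ⁆ * δ := by rw [commutatorElement_def]; group
      have hc : Commute (lin ⁅γ, δ⁆ ^ k) (lin γ) := Commute.pow_left h k
      calc _ = lin γ * (lin ⁅γ, δ⁆ ^ k * lin δ) * lin γ⁻¹ := by rw [e, lin_mul, lin_mul, ih]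
        _ = lin ⁅γ, δ⁆ ^ k * (lin γ * lin δ * lin γ⁻¹) := by
          rw [← mul_assoc, ← hc.eq]; simp only [mul_assoc]
        _ = lin ⁅γ, δ⁆ ^ k * (lin ⁅γ, δ⁆ * lin δ) := by
          rw [← lin_mul, ← lin_mul, e2, lin_mul]
        _ = _ := by rw [pow_succ, mul_assoc]
  refine eq_one_of_forall_norm_pow_sub_one_le fun k => ?_
  have e : lin ⁅γ, δ⁆ ^ k - 1
      = (lin (γ ^ k * δ * (γ ^ k)⁻¹) - 1) - lin ⁅γ, δ⁆ ^ k * (lin δ - 1) := by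
    rw [key]; noncomm_ring
  rw [e]
  have h1 := norm_sub_le (lin (γ ^ k * δ * (γ ^ k)⁻¹) - 1) (lin ⁅γ, δ⁆ ^ k * (lin δ - 1))
  have h2 := norm_lin_conj_sub_one_le (γ ^ k) δ
  have h3 := norm_lin_mul_le (⁅γ, δ⁆ ^ k) (lin δ - 1)
  rw [lin_pow] at h3
  linarith

theorem norm_lin_commutator_sub_one_le (γ δ : V ≃ᵢ V) :
    ‖lin ⁅γ, δ⁆ - 1‖ ≤ 2 * ‖lin γ - 1‖ * ‖lin δ - 1‖ := by
  have e : lin ⁅γ, δ⁆ - 1 = ((lin γ - 1) * (lin δ - 1) - (lin δ - 1) * (lin γ - 1))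
      * lin (γ⁻¹ * δ⁻¹) := by
    have e1 : (lin γ - 1) * (lin δ - 1) - (lin δ - 1) * (lin γ - 1)
        = lin (γ * δ) - lin (δ * γ) := by
      rw [lin_mul, lin_mul]; noncomm_ring
    rw [e1, sub_mul, ← lin_mul, ← lin_mul, commutatorElement_def, ← lin_one]
    congr 2; group
  rw [e]
  refine (norm_mul_lin_le _ _).trans ((norm_sub_le _ _).trans ?_)
  have h1 := norm_mul_le (lin γ - 1) (lin δ - 1)
  have h2 := norm_mul_le (lin δ - 1) (lin γ - 1)
  linarith

theorem dist_commutator_le (γ δ : V ≃ᵢ V) (x : V) :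
    dist (⁅γ, δ⁆ x) x ≤ ‖lin γ - 1‖ * dist (δ x) x + ‖lin δ - 1‖ * dist (γ x) x
      + 2 * ‖lin γ - 1‖ * ‖lin δ - 1‖ * (dist (γ x) x + dist (δ x) x) := by
  have hz : ⁅γ, δ⁆ (δ (γ x)) = γ (δ x) := by
    have : ⁅γ, δ⁆ * (δ * γ) = γ * δ := by rw [commutatorElement_def]; group
    exact DFunLike.congr_fun this x
  have e : ⁅γ, δ⁆ x - x = (lin ⁅γ, δ⁆ - 1) (x - δ (γ x))
      + ((lin γ - 1) (δ x - x) - (lin δ - 1) (γ x - x)) := by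
    simp only [sub_apply, one_apply_eq_self, lin_sub, hz]
    abel
  rw [dist_eq_norm, e]
  have h0 : ‖x - δ (γ x)‖ ≤ dist (γ x) x + dist (δ x) x := by
    rw [← dist_eq_norm, dist_comm]
    refine (dist_triangle _ (δ x) _).trans ?_
    rw [δ.dist_eq]
  have h1 := (lin ⁅γ, δ⁆ - 1).le_opNorm (x - δ (γ x))
  have h2 := (lin γ - 1).le_opNorm (δ x - x)
  have h3 := (lin δ - 1).le_opNorm (γ x - x)
  rw [← dist_eq_norm (δ x)] at h2
  rw [← dist_eq_norm (γ x)] at h3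
  have h4 := mul_le_mul (norm_lin_commutator_sub_one_le γ δ) h0 (norm_nonneg _) (by positivity)
  refine (norm_add_le _ _).trans ?_
  have h5 := norm_sub_le ((lin γ - 1) (δ x - x)) ((lin δ - 1) (γ x - x))
  linarith

end LinearPart

section DiscreteGroups

open scoped commutatorElement

variable {V : Type*} [NormedAddCommGroup V] [InnerProductSpace ℝ V]

theorem inner_lin_lin (γ : V ≃ᵢ V) (x y : V) : inner ℝ (lin γ x) (lin γ y) = inner ℝ x y :=
  γ.toRealAffineIsometryEquiv.linearIsometryEquiv.inner_map_map x y

theorem inner_lin_inv (γ : V ≃ᵢ V) (x y : V) :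
    inner ℝ (lin γ⁻¹ x) y = inner ℝ x (lin γ y) := by
  rw [← inner_lin_lin γ]
  congr 1
  exact DFunLike.congr_fun (lin_mul_inv γ) x

theorem exists_pos_forall_le {ι : Type*} {s : Set ι} (hs : s.Finite) {f : ι → ℝ}
    (hf : ∀ i ∈ s, 0 < f i) : ∃ c > 0, ∀ i ∈ s, c ≤ f i := by
  induction s, hs using Set.Finite.induction_on with
  | empty => exact ⟨1, one_pos, by simp⟩
  | @insert a s _ _ ih =>
    obtain ⟨c, hc, h⟩ := ih fun i hi => hf i (mem_insert_of_mem _ hi)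
    refine ⟨min c (f a), lt_min hc (hf a (mem_insert _ _)), fun i hi => ?_⟩
    rcases hi with rfl | hi
    · exact min_le_right _ _
    · exact (min_le_left _ _).trans (h i hi)

/-- The linear part of `γ` moves some vector of the unit ball by at least `c`. -/
def MovesBy (c : ℝ) (γ : V ≃ᵢ V) : Prop := ∃ e : V, ‖e‖ ≤ 1 ∧ c ≤ ‖lin γ e - e‖

theorem MovesBy.mono {c c' : ℝ} (hc : c' ≤ c) {γ : V ≃ᵢ V} (h : MovesBy c γ) : MovesBy c' γ :=
  let ⟨e, he, h⟩ := h
  ⟨e, he, hc.trans h⟩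

theorem MovesBy.conj {c : ℝ} {γ : V ≃ᵢ V} (h : MovesBy c γ) (ρ : V ≃ᵢ V) :
    MovesBy c (ρ * γ * ρ⁻¹) := by
  obtain ⟨e, he, h⟩ := h
  refine ⟨lin ρ e, (norm_lin_apply ρ e).trans_le he, ?_⟩
  have h1 : lin (ρ * γ * ρ⁻¹) (lin ρ e) = lin ρ (lin γ e) := by
    have : lin (ρ * γ * ρ⁻¹) * lin ρ = lin ρ * lin γ := by
      rw [← lin_mul, ← lin_mul, inv_mul_cancel_right]
    exact DFunLike.congr_fun this e
  rwa [h1, ← map_sub, norm_lin_apply]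

theorem exists_movesBy {γ : V ≃ᵢ V} (h : lin γ ≠ 1) : ∃ c > 0, MovesBy c γ := by
  obtain ⟨v, hv⟩ : ∃ v, lin γ v ≠ v := by
    by_contra! hcon
    exact h (ContinuousLinearMap.ext hcon)
  have hv0 : v ≠ 0 := by rintro rfl; simp at hv
  refine ⟨‖lin γ (‖v‖⁻¹ • v) - ‖v‖⁻¹ • v‖, norm_pos_iff.2 ?_, ‖v‖⁻¹ • v, ?_, le_rfl⟩
  · rw [map_smul, ← smul_sub]
    exact smul_ne_zero (inv_ne_zero (norm_ne_zero_iff.2 hv0)) (sub_ne_zero.2 hv)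
  · rw [norm_smul, norm_inv, norm_norm, inv_mul_cancel₀ (norm_ne_zero_iff.2 hv0)]

/-- Near every point there is a point which is moved far away by each of finitely many isometries
that are uniformly far from being translations. -/
theorem exists_forall_le_dist {c : ℝ} (hc : 0 < c) (r : ℝ) (M : ℕ) :
    ∃ R : ℝ, 0 ≤ R ∧ ∀ F : Finset (V ≃ᵢ V), F.card ≤ M → (∀ γ ∈ F, MovesBy c γ) →
      ∀ x, ∃ x', dist x x' ≤ R ∧ ∀ γ ∈ F, r ≤ dist (γ x') x' := by
  classical
  induction M with
  | zero =>
    refine ⟨0, le_rfl, fun F hF _ x => ⟨x, by simp, ?_⟩⟩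
    rw [Finset.card_eq_zero.1 (Nat.le_zero.1 hF)]
    simp
  | succ M ih =>
    obtain ⟨R, hR, ih⟩ := ih
    set s : ℝ := (|r| + 2 * R) / c with hs
    have hs0 : 0 ≤ s := by positivity
    have hsc : s * c = |r| + 2 * R := div_mul_cancel₀ _ hc.ne'
    refine ⟨s + R, by positivity, fun F hF hmov x => ?_⟩
    rcases F.eq_empty_or_nonempty with rfl | ⟨γ, hγ⟩
    · exact ⟨x, by rw [dist_self]; positivity, by simp⟩
    obtain ⟨e, he, hce⟩ := hmov γ hγ
    obtain ⟨x₁, hx₁, hd⟩ : ∃ x₁, dist x x₁ ≤ s ∧ s * c ≤ dist (γ x₁) x₁ := by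
      have hse : ‖s • e‖ ≤ s := by
        rw [norm_smul, Real.norm_of_nonneg hs0]
        exact mul_le_of_le_one_right hs0 he
      by_contra! hcon
      have h1 := hcon (x + s • e) (by simpa [dist_eq_norm] using hse)
      have h2 := hcon (x - s • e) (by simpa [dist_eq_norm] using hse)
      have e1 : (2 * s) • (lin γ e - e)
          = (γ (x + s • e) - (x + s • e)) - (γ (x - s • e) - (x - s • e)) := by
        have := lin_sub γ (x + s • e) (x - s • e)
        have e2 : x + s • e - (x - s • e) = (2 * s) • e := by module
        rw [e2, map_smul] at this
        rw [smul_sub, this]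
        module
      have h3 := norm_sub_le (γ (x + s • e) - (x + s • e)) (γ (x - s • e) - (x - s • e))
      rw [← e1, norm_smul, Real.norm_of_nonneg (by positivity), ← dist_eq_norm (γ _),
        ← dist_eq_norm (γ _)] at h3
      nlinarith
    obtain ⟨x₂, hx₂, hF₂⟩ := ih (F.erase γ)
      (by rw [Finset.card_erase_of_mem hγ]; omega)
      (fun δ hδ => hmov δ (Finset.mem_of_mem_erase hδ)) x₁
    refine ⟨x₂, (dist_triangle x x₁ x₂).trans (add_le_add hx₁ hx₂), fun δ hδ => ?_⟩
    by_cases h : δ = γ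
    · subst h
      have := dist_apply_le δ x₁ x₂
      have := le_abs_self r
      linarith
    · exact hF₂ δ (Finset.mem_erase.2 ⟨h, hδ⟩)

/-- Finitely many isometries which are not translations move some point far away. -/
theorem exists_forall_lt_dist {s : Set (V ≃ᵢ V)} (hs : s.Finite) (h : ∀ γ ∈ s, lin γ ≠ 1)
    (r : ℝ) : ∃ x, ∀ γ ∈ s, r < dist (γ x) x := by
  have h' : ∀ γ : V ≃ᵢ V, ∃ c, γ ∈ s → 0 < c ∧ MovesBy c γ := fun γ => by
    by_cases hγ : γ ∈ s
    · obtain ⟨c, hc⟩ := exists_movesBy (h γ hγ)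
      exact ⟨c, fun _ => hc⟩
    · exact ⟨0, fun h => absurd h hγ⟩
  choose f hf using h'
  obtain ⟨c, hc, hcf⟩ := exists_pos_forall_le hs fun γ hγ => (hf γ hγ).1
  obtain ⟨R, -, hR⟩ := exists_forall_le_dist (V := V) hc (r + 1) hs.toFinset.card
  obtain ⟨x, -, hx⟩ := hR hs.toFinset le_rfl
    (fun γ hγ => (hf γ (hs.mem_toFinset.1 hγ)).2.mono (hcf γ (hs.mem_toFinset.1 hγ))) 0
  refine ⟨x, fun γ hγ => ?_⟩
  have := hx γ (hs.mem_toFinset.2 hγ)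
  linarith

theorem exists_finset_card_eq {c : ℝ} (hc : 0 < c) {S : Set (V ≃ᵢ V)}
    (hS : ∀ γ ∈ S, MovesBy c γ) {C : ℝ} (h : ∀ x, ∃ γ ∈ S, dist (γ x) x ≤ C) (M : ℕ) :
    ∃ R : ℝ, ∀ x, ∃ F : Finset (V ≃ᵢ V), F.card = M ∧ ∀ γ ∈ F, γ ∈ S ∧ dist (γ x) x ≤ R := by
  classical
  induction M with
  | zero => exact ⟨0, fun x => ⟨∅, by simp, by simp⟩⟩
  | succ M ih =>
    obtain ⟨R, ih⟩ := ih
    obtain ⟨R', -, hR'⟩ := exists_forall_le_dist (V := V) hc (C + 1) M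
    refine ⟨max R (C + 2 * R'), fun x => ?_⟩
    obtain ⟨F, hF, hFS⟩ := ih x
    obtain ⟨x', hx', hd⟩ := hR' F hF.le (fun γ hγ => hS γ (hFS γ hγ).1) x
    obtain ⟨γ, hγS, hγ⟩ := h x'
    have hγF : γ ∉ F := fun hmem => by linarith [hd γ hmem]
    refine ⟨insert γ F, by rw [Finset.card_insert_of_notMem hγF, hF], fun δ hδ => ?_⟩
    rcases Finset.mem_insert.1 hδ with rfl | hδ
    · refine ⟨hγS, le_max_of_le_right ?_⟩
      have := dist_apply_le δ x x'
      linarith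
    · exact ⟨(hFS δ hδ).1, le_max_of_le_left (hFS δ hδ).2⟩

theorem exists_card_imp_norm_lin_sub_le [FiniteDimensional ℝ V] {η : ℝ} (hη : 0 < η) :
    ∃ M : ℕ, ∀ F : Finset (V ≃ᵢ V), M < F.card →
      ∃ γ ∈ F, ∃ δ ∈ F, γ ≠ δ ∧ ‖lin γ - lin δ‖ ≤ η := by
  obtain ⟨t, -, ht, hcov⟩ :=
    (isCompact_closedBall (0 : V →L[ℝ] V) 1).finite_cover_balls (half_pos hη)
  have hex : ∀ γ : V ≃ᵢ V, ∃ a ∈ t, lin γ ∈ ball a (η / 2) := fun γ => by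
    simpa using hcov (show lin γ ∈ closedBall 0 1 by simpa using norm_lin_le γ)
  choose f hft hf using hex
  refine ⟨ht.toFinset.card, fun F hF => ?_⟩
  obtain ⟨γ, hγ, δ, hδ, hne, heq⟩ :=
    Finset.exists_ne_map_eq_of_card_lt_of_maps_to hF (f := f) (fun γ _ => by simpa using hft γ)
  refine ⟨γ, hγ, δ, hδ, hne, ?_⟩
  have h1 := hf γ
  have h2 := hf δ
  rw [← heq] at h2
  rw [mem_ball] at h1 h2
  rw [← dist_eq_norm]
  linarith [dist_triangle_right (lin γ) (lin δ) (f γ)]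

theorem exists_small {Γ : Subgroup (V ≃ᵢ V)} [FiniteDimensional ℝ V] {c : ℝ} (hc : 0 < c) {C : ℝ}
    (h : ∀ x, ∃ γ ∈ Γ, MovesBy c γ ∧ dist (γ x) x ≤ C) {η : ℝ} (hη : 0 < η) :
    ∃ R : ℝ, ∀ x, ∃ γ ∈ Γ, γ ≠ 1 ∧ ‖lin γ - 1‖ ≤ η ∧ dist (γ x) x ≤ R := by
  obtain ⟨M, hM⟩ := exists_card_imp_norm_lin_sub_le (V := V) hη
  obtain ⟨R, hR⟩ := exists_finset_card_eq hc (S := {γ | γ ∈ Γ ∧ MovesBy c γ}) (fun γ hγ => hγ.2)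
    (fun x => by obtain ⟨γ, h1, h2, h3⟩ := h x; exact ⟨γ, ⟨h1, h2⟩, h3⟩) (M + 1)
  refine ⟨R + R, fun x => ?_⟩
  obtain ⟨F, hF, hFR⟩ := hR x
  obtain ⟨γ, hγ, δ, hδ, hne, hle⟩ := hM F (by omega)
  refine ⟨γ * δ⁻¹, Γ.mul_mem (hFR γ hγ).1.1 (Γ.inv_mem (hFR δ hδ).1.1),
    fun h => hne (mul_inv_eq_one.1 h), ?_, ?_⟩
  · have e : lin (γ * δ⁻¹) - 1 = (lin γ - lin δ) * lin δ⁻¹ := by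
      rw [sub_mul, lin_mul, lin_mul_inv]
    rw [e]
    exact (norm_mul_lin_le _ _).trans hle
  · exact (dist_mul_inv_apply_le γ δ x).trans (add_le_add (hFR γ hγ).2 (hFR δ hδ).2)

theorem commute_lin_of_lin_commutator_eq_one {γ δ : V ≃ᵢ V} (h : lin ⁅γ, δ⁆ = 1) :
    lin δ * lin γ = lin γ * lin δ := by
  have : ⁅γ, δ⁆ * (δ * γ) = γ * δ := by rw [commutatorElement_def]; group
  have := congrArg lin this
  rwa [lin_mul, h, one_mul, lin_mul, lin_mul] at this

/-- In a discrete group of isometries without translations, elements whose linear parts are close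
to the identity commute. -/
theorem commutator_eq_one {Γ : Subgroup (V ≃ᵢ V)}
    (hΓ : {γ | γ ∈ Γ ∧ dist (γ 0) 0 ≤ 1}.Finite) (htr : ∀ γ ∈ Γ, lin γ = 1 → γ = 1)
    {γ δ : V ≃ᵢ V} (hγ : γ ∈ Γ) (hδ : δ ∈ Γ) (hγs : ‖lin γ - 1‖ ≤ 1 / 8)
    (hδs : ‖lin δ - 1‖ ≤ 1 / 8) : ⁅γ, δ⁆ = 1 := by
  set a := dist (γ 0) 0 with ha
  have ha0 : 0 ≤ a := dist_nonneg
  let Φ : (V ≃ᵢ V) → ℝ := fun τ => dist (τ 0) 0 + (8 * a + 1) * ‖lin τ - 1‖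
  obtain ⟨ε, hε, hεΦ⟩ := exists_pos_forall_le (hΓ.subset (sdiff_subset (t := {1}))) (f := Φ) (by
    rintro τ ⟨-, hτ⟩
    have h0 : 0 ≤ dist (τ 0) 0 := dist_nonneg
    have h1 : 0 ≤ (8 * a + 1) * ‖lin τ - 1‖ := by positivity
    refine (add_nonneg h0 h1).lt_of_ne fun h => hτ ?_
    have h2 : dist (τ 0) 0 = 0 := by linarith
    have h3 : (8 * a + 1) * ‖lin τ - 1‖ = 0 := by linarith
    have h4 : ‖lin τ - 1‖ = 0 := (mul_eq_zero.1 h3).resolve_left (by positivity)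
    exact eq_one_of_lin_eq_one (sub_eq_zero.1 (norm_eq_zero.1 h4)) (dist_eq_zero.1 h2))
  let d : ℕ → (V ≃ᵢ V) := fun k => (fun τ => ⁅γ, τ⁆)^[k] δ
  have d_succ : ∀ k, d (k + 1) = ⁅γ, d k⁆ := fun k => Function.iterate_succ_apply' _ _ _
  have hd : ∀ k, d k ∈ Γ ∧ ‖lin (d k) - 1‖ ≤ 1 / 8 ∧ Φ (d k) ≤ (1 / 2) ^ k * Φ δ := by
    intro k
    induction k with
    | zero => exact ⟨hδ, hδs, by simp [d]⟩
    | succ k ih =>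
      obtain ⟨h1, h2, h3⟩ := ih
      have h4 := norm_lin_commutator_sub_one_le γ (d k)
      have h5 := dist_commutator_le γ (d k) 0
      rw [d_succ]
      set b := dist (d k 0) 0
      set β := ‖lin (d k) - 1‖
      set α := ‖lin γ - 1‖
      have hb : 0 ≤ b := dist_nonneg
      have hβ : 0 ≤ β := norm_nonneg _
      have hα : 0 ≤ α := norm_nonneg _
      have h6 : ‖lin ⁅γ, d k⁆ - 1‖ ≤ β / 4 := by nlinarith
      refine ⟨?_, by linarith, ?_⟩
      · rw [commutatorElement_def]
        exact Γ.mul_mem (Γ.mul_mem (Γ.mul_mem hγ h1) (Γ.inv_mem hγ)) (Γ.inv_mem h1)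
      · have h7 : dist (⁅γ, d k⁆ 0) 0 ≤ b / 2 + 2 * β * a := by
          have i1 : α * b ≤ 1 / 8 * b := mul_le_mul_of_nonneg_right hγs hb
          have i2 : 2 * α * β ≤ β / 4 := by nlinarith
          have i3 : 2 * α * β * (a + b) ≤ β / 4 * (a + b) :=
            mul_le_mul_of_nonneg_right i2 (add_nonneg ha0 hb)
          have i4 : β * b ≤ 1 / 8 * b := mul_le_mul_of_nonneg_right h2 hb
          have i5 : 0 ≤ β * a := mul_nonneg hβ ha0
          nlinarith
        have h8 : Φ ⁅γ, d k⁆ ≤ 1 / 2 * Φ (d k) := by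
          change _ + _ * _ ≤ 1 / 2 * (b + (8 * a + 1) * β)
          have i1 : (8 * a + 1) * ‖lin ⁅γ, d k⁆ - 1‖ ≤ (8 * a + 1) * (β / 4) :=
            mul_le_mul_of_nonneg_left h6 (by positivity)
          nlinarith [mul_nonneg hβ ha0]
        rw [pow_succ]
        linarith
  obtain ⟨K, hK⟩ : ∃ K, d (K + 1) = 1 := by
    have hlim : Filter.Tendsto (fun k : ℕ => (1 / 2 : ℝ) ^ k * Φ δ) Filter.atTop (nhds (0 * Φ δ)) :=
      (tendsto_pow_atTop_nhds_zero_of_lt_one (by norm_num) (by norm_num)).mul_const _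
    rw [zero_mul] at hlim
    obtain ⟨K, hK⟩ := (hlim.eventually (gt_mem_nhds (lt_min hε one_pos))).exists_forall_of_atTop
    refine ⟨K, by_contra fun hne => ?_⟩
    have h1 := (hd (K + 1)).2.2.trans_lt (hK (K + 1) (by omega))
    have h2 : dist (d (K + 1) 0) 0 ≤ Φ (d (K + 1)) :=
      le_add_of_nonneg_right (by positivity)
    exact absurd (hεΦ (d (K + 1)) ⟨⟨(hd _).1, h2.trans (h1.trans_le (min_le_right _ _)).le⟩, hne⟩)
      (not_le.2 (h1.trans_le (min_le_left _ _)))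
  have hdown : ∀ k, lin (d (k + 1)) = 1 → lin (d 1) = 1 := by
    intro k
    induction k with
    | zero => exact id
    | succ k ih =>
      intro h
      refine ih ?_
      rw [d_succ] at h
      have := commute_lin_of_lin_commutator_eq_one h
      rw [d_succ] at this ⊢
      exact lin_commutator_eq_one (hd k).2.1 this
  exact htr _ (hd 1).1 (hdown K (by rw [hK, lin_one]))

theorem isBounded_of_forall_exists_inner_le [FiniteDimensional ℝ V] {Y : Set V}
    (h : ∀ u : V, ∃ K, ∀ y ∈ Y, |inner ℝ u y| ≤ K) : ∃ K, ∀ y ∈ Y, ‖y‖ ≤ K := by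
  choose K hK using h
  let b := stdOrthonormalBasis ℝ V
  refine ⟨∑ i, K (b i), fun y hy => ?_⟩
  rw [← b.sum_repr' y]
  refine (norm_sum_le _ _).trans (Finset.sum_le_sum fun i _ => ?_)
  rw [norm_smul, b.orthonormal.1 i, mul_one]
  exact hK (b i) y hy

/-- A family of pairwise commuting isometries which have displacement at most `R` somewhere has
bounded displacement at the origin. -/
theorem exists_dist_le_of_commute [FiniteDimensional ℝ V] {S : Set (V ≃ᵢ V)}
    (hS : ∀ γ ∈ S, ∀ δ ∈ S, Commute γ δ) (R : ℝ) :
    ∃ K, ∀ γ ∈ S, (∃ x, dist (γ x) x ≤ R) → dist (γ 0) 0 ≤ K := by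
  let Y : Set V := {y | ∃ γ ∈ S, (∃ x, dist (γ x) x ≤ R) ∧ γ 0 = y}
  let W : Submodule ℝ V :=
    { carrier := {u | ∃ K, ∀ y ∈ Y, |inner ℝ u y| ≤ K}
      zero_mem' := ⟨0, fun y _ => by simp⟩
      add_mem' := by
        rintro u v ⟨K, hK⟩ ⟨L, hL⟩
        refine ⟨K + L, fun y hy => ?_⟩
        rw [inner_add_left]
        exact (abs_add_le _ _).trans (add_le_add (hK y hy) (hL y hy))
      smul_mem' := by
        rintro t u ⟨K, hK⟩
        refine ⟨|t| * K, fun y hy => ?_⟩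
        rw [real_inner_smul_left, abs_mul]
        exact mul_le_mul_of_nonneg_left (hK y hy) (abs_nonneg t) }
  have hW : ∀ γ ∈ S, ∀ u, lin γ⁻¹ u - u ∈ W := by
    intro γ hγ u
    refine ⟨‖u‖ * (dist (γ 0) 0 + dist (γ 0) 0), ?_⟩
    rintro y ⟨δ, hδ, -, rfl⟩
    rw [inner_sub_left, inner_lin_inv, ← inner_sub_right]
    refine (abs_real_inner_le_norm _ _).trans (mul_le_mul_of_nonneg_left ?_ (norm_nonneg u))
    have hc : γ (δ 0) = δ (γ 0) := DFunLike.congr_fun (hS γ hγ δ hδ).eq 0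
    rw [lin_apply, hc, sub_right_comm]
    refine (norm_sub_le _ _).trans ?_
    rw [← dist_eq_norm, δ.dist_eq, dist_zero_right]
  have hWtop : W = ⊤ := by
    rw [← Submodule.orthogonal_eq_bot_iff, Submodule.eq_bot_iff]
    intro z hz
    have hfix : ∀ γ ∈ S, lin γ z = z := by
      intro γ hγ
      rw [← sub_eq_zero, ← inner_self_eq_zero (𝕜 := ℝ), inner_sub_right _ (lin γ z), ← inner_lin_inv,
        ← inner_sub_left]
      exact (Submodule.mem_orthogonal W z).1 hz _ (hW γ hγ _)
    have hzW : z ∈ W := by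
      refine ⟨‖z‖ * R, ?_⟩
      rintro y ⟨γ, hγ, ⟨x, hx⟩, rfl⟩
      have e : inner ℝ z (γ 0) = inner ℝ z (γ x - x) := by
        have e1 : γ 0 = (γ x - x) - (lin γ x - x) := by rw [lin_apply]; abel
        have e2 : inner ℝ z (lin γ x) = inner ℝ z x := by
          nth_rw 1 [← hfix γ hγ]
          exact inner_lin_lin γ z x
        rw [e1, inner_sub_right _ _ (lin γ x - x), inner_sub_right _ (lin γ x), e2]
        simp
      rw [e]
      refine (abs_real_inner_le_norm _ _).trans (mul_le_mul_of_nonneg_left ?_ (norm_nonneg z))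
      rwa [← dist_eq_norm]
    exact inner_self_eq_zero.1 ((Submodule.mem_orthogonal W z).1 hz z hzW)
  obtain ⟨K, hK⟩ := isBounded_of_forall_exists_inner_le (Y := Y) fun u => by
    have : u ∈ W := hWtop ▸ Submodule.mem_top
    exact this
  exact ⟨K, fun γ hγ hx => by simpa using hK _ ⟨γ, hγ, hx, rfl⟩⟩

/-- If conjugates of a fixed nontrivial isometry which lie in a discrete group have bounded
displacement at every point, then the group contains a nontrivial translation. -/
theorem exists_translation_mem [FiniteDimensional ℝ V] {Γ : Subgroup (V ≃ᵢ V)}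
    (hΓ : ∀ K : ℝ, {γ | γ ∈ Γ ∧ dist (γ 0) 0 ≤ K}.Finite) {τ : V ≃ᵢ V} (hτ : τ ≠ 1) {C : ℝ}
    (h : ∀ x, ∃ ρ : V ≃ᵢ V, ρ * τ * ρ⁻¹ ∈ Γ ∧ dist ((ρ * τ * ρ⁻¹) x) x ≤ C) :
    ∃ γ ∈ Γ, γ ≠ 1 ∧ lin γ = 1 := by
  by_contra! hcon
  have htr : ∀ γ ∈ Γ, lin γ = 1 → γ = 1 := fun γ hγ hl => by_contra fun hne => hcon γ hγ hne hl
  have hτl : lin τ ≠ 1 := by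
    intro hl
    obtain ⟨ρ, hρ, -⟩ := h 0
    refine hcon _ hρ (fun h1 => hτ (conj_eq_one_iff.1 h1)) ?_
    rw [lin_mul, lin_mul, hl, mul_one, lin_mul_inv]
  obtain ⟨c, hc, hmov⟩ := exists_movesBy hτl
  obtain ⟨R, hR⟩ := exists_small (Γ := Γ) hc (C := C) (fun x => by
    obtain ⟨ρ, h1, h2⟩ := h x
    exact ⟨_, h1, hmov.conj ρ, h2⟩) (η := 1 / 8) (by norm_num)
  let S : Set (V ≃ᵢ V) := {γ | γ ∈ Γ ∧ ‖lin γ - 1‖ ≤ 1 / 8}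
  obtain ⟨K, hK⟩ := exists_dist_le_of_commute (S := S) (fun γ hγ δ hδ =>
    commutatorElement_eq_one_iff_commute.1 (commutator_eq_one (hΓ 1) htr hγ.1 hδ.1 hγ.2 hδ.2)) R
  obtain ⟨x, hx⟩ := exists_forall_lt_dist
    (s := {γ | γ ∈ Γ ∧ dist (γ 0) 0 ≤ K} \ {1}) ((hΓ K).subset sdiff_subset)
    (fun γ hγ hl => hγ.2 (htr γ hγ.1.1 hl)) R
  obtain ⟨γ, hγ, hne, hsm, hd⟩ := hR x
  exact absurd (hx γ ⟨⟨hγ, hK γ ⟨hγ, hsm⟩ ⟨x, hd⟩⟩, hne⟩) (not_lt.2 hd)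

end DiscreteGroups

section Balls

variable {X : Type*}

theorem bt_subset {A : Set (Set X)} {T : Set X} (hT : T ∈ A) (r : ℕ) : bt A T r ⊆ A := by
  cases r with
  | zero => rintro U rfl; exact hT
  | succ r => exact fun U hU => hU.1

theorem bt_trans {A : Set (Set X)} {S T U : Set X} {a b : ℕ} (hT : T ∈ bt A S a)
    (hU : U ∈ bt A T b) : U ∈ bt A S (a + b) := by
  induction b generalizing U with
  | zero => obtain rfl := hU; exact hT
  | succ b ih =>
    obtain ⟨hUA, W, hW, h⟩ := hU
    exact ⟨hUA, W, ih hW, h⟩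

theorem bt_mono {A : Set (Set X)} (hA : ∅ ∉ A) {T : Set X} (hT : T ∈ A) :
    Monotone (bt A T) := by
  refine monotone_nat_of_le_succ fun r U hU => ?_
  have hUA := bt_subset hT r hU
  have hne : U.Nonempty := nonempty_iff_ne_empty.2 fun h => hA (h ▸ hUA)
  exact ⟨hUA, U, hU, by rwa [inter_self]⟩

theorem exists_mem_bt_symm {A : Set (Set X)} {S T : Set X} (hS : S ∈ A) {a : ℕ}
    (hT : T ∈ bt A S a) : ∃ b, S ∈ bt A T b := by
  induction a generalizing T with
  | zero => exact ⟨0, by obtain rfl := hT; rfl⟩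
  | succ a ih =>
    obtain ⟨-, W, hW, h⟩ := hT
    obtain ⟨b, hb⟩ := ih hW
    exact ⟨1 + b, bt_trans ⟨bt_subset hS a hW, T, rfl, by rwa [inter_comm]⟩ hb⟩

theorem self_mem_bt {A : Set (Set X)} (hA : ∅ ∉ A) {T : Set X} (hT : T ∈ A) (r : ℕ) :
    T ∈ bt A T r :=
  bt_mono hA hT (Nat.zero_le r) rfl

theorem bt_subset_bt {A B : Set (Set X)} (hA : ∅ ∉ A) {T : Set X} (hT : T ∈ A) {r : ℕ}
    (h : bt A T r ⊆ B) {j : ℕ} (hj : j ≤ r) : bt A T j ⊆ bt B T j := by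
  induction j with
  | zero => exact Subset.rfl
  | succ j ih =>
    rintro U ⟨hU, W, hW, hUW⟩
    exact ⟨h (bt_mono hA hT hj ⟨hU, W, hW, hUW⟩), W, ih (by omega) hW, hUW⟩

theorem isPatch_bt {A : Set (Set X)} (hA : ∅ ∉ A) {T : Set X} (hT : T ∈ A) (r : ℕ) :
    IsPatch (bt A T r) := by
  intro S hS U hU
  have hsub : bt A T r ⊆ bt (bt A T r) T r := bt_subset_bt hA hT Subset.rfl le_rfl
  obtain ⟨b, hb⟩ := exists_mem_bt_symm (self_mem_bt hA hT r) (hsub hS)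
  exact ⟨b + r, bt_trans hb (hsub hU)⟩

end Balls

section Tiles

variable {X : Type*} [MetricSpace X]

theorem tmap_mul (σ τ : X ≃ᵢ X) (T : Set X) : tmap (σ * τ) T = tmap σ (tmap τ T) :=
  image_comp σ τ T

theorem tmap_one (T : Set X) : tmap (1 : X ≃ᵢ X) T = T := image_id T

theorem tmap_inv_tmap (σ : X ≃ᵢ X) (T : Set X) : tmap σ⁻¹ (tmap σ T) = T := by
  rw [← tmap_mul, inv_mul_cancel, tmap_one]

theorem tmap_tmap_inv (σ : X ≃ᵢ X) (T : Set X) : tmap σ (tmap σ⁻¹ T) = T := by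
  rw [← tmap_mul, mul_inv_cancel, tmap_one]

theorem tmap_injective (σ : X ≃ᵢ X) : Function.Injective (tmap σ) :=
  Function.LeftInverse.injective (tmap_inv_tmap σ)

theorem smap_mul (σ τ : X ≃ᵢ X) (A : Set (Set X)) : smap (σ * τ) A = smap σ (smap τ A) := by
  simp only [smap, image_image, tmap_mul]

theorem smap_one (A : Set (Set X)) : smap (1 : X ≃ᵢ X) A = A := by
  simp [smap, tmap_one]

theorem smap_inv_smap (σ : X ≃ᵢ X) (A : Set (Set X)) : smap σ⁻¹ (smap σ A) = A := by
  rw [← smap_mul, inv_mul_cancel, smap_one]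

theorem smap_mono (σ : X ≃ᵢ X) {A B : Set (Set X)} (h : A ⊆ B) : smap σ A ⊆ smap σ B :=
  image_mono h

theorem tmap_mem_smap {σ : X ≃ᵢ X} {A : Set (Set X)} {U : Set X} :
    tmap σ U ∈ smap σ A ↔ U ∈ A :=
  (tmap_injective σ).mem_set_image

theorem mem_smap {σ : X ≃ᵢ X} {A : Set (Set X)} {U : Set X} :
    U ∈ smap σ A ↔ tmap σ⁻¹ U ∈ A := by
  rw [← tmap_mem_smap (σ := σ) (U := tmap σ⁻¹ U), tmap_tmap_inv]

theorem ncard_smap (σ : X ≃ᵢ X) (A : Set (Set X)) : (smap σ A).ncard = A.ncard :=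
  ncard_image_of_injective _ (tmap_injective σ)

theorem empty_notMem_smap {A : Set (Set X)} (h : ∅ ∉ A) (σ : X ≃ᵢ X) : ∅ ∉ smap σ A := by
  rw [mem_smap]
  simpa [tmap] using h

theorem sUnion_smap (σ : X ≃ᵢ X) (A : Set (Set X)) : ⋃₀ smap σ A = σ '' ⋃₀ A := by
  rw [sUnion_eq_biUnion, sUnion_eq_biUnion, image_iUnion₂, smap, biUnion_image]
  rfl

theorem inter_tmap_nonempty (σ : X ≃ᵢ X) (U W : Set X) :
    (tmap σ U ∩ tmap σ W).Nonempty ↔ (U ∩ W).Nonempty := by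
  rw [tmap, tmap, ← image_inter σ.injective, image_nonempty]

theorem bt_smap (σ : X ≃ᵢ X) (A : Set (Set X)) (T : Set X) (r : ℕ) :
    bt (smap σ A) (tmap σ T) r = smap σ (bt A T r) := by
  induction r with
  | zero => simp [bt, smap]
  | succ r ih =>
    ext U
    rw [← tmap_tmap_inv σ U, tmap_mem_smap]
    simp only [bt, ih, mem_ofPred_eq, tmap_mem_smap]
    refine and_congr_right fun _ => ⟨?_, ?_⟩
    · rintro ⟨_, ⟨W, hW, rfl⟩, h⟩
      exact ⟨W, hW, (inter_tmap_nonempty σ _ _).1 h⟩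
    · rintro ⟨W, hW, h⟩
      exact ⟨tmap σ W, tmap_mem_smap.2 hW, (inter_tmap_nonempty σ _ _).2 h⟩

theorem bt_smap' (σ : X ≃ᵢ X) (A : Set (Set X)) (T : Set X) (r : ℕ) :
    bt (smap σ A) T r = smap σ (bt A (tmap σ⁻¹ T) r) := by
  rw [← bt_smap, tmap_tmap_inv]

theorem IsPatch.smap {A : Set (Set X)} (hA : IsPatch A) (σ : X ≃ᵢ X) : IsPatch (smap σ A) := by
  rintro _ ⟨S, hS, rfl⟩ _ ⟨T, hT, rfl⟩
  obtain ⟨r, hr⟩ := hA S hS T hT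
  exact ⟨r, by rwa [bt_smap, tmap_mem_smap]⟩

/-- Every tile of `A` has diameter at most `D`. -/
def DiamLE (A : Set (Set X)) (D : ℝ) : Prop := ∀ T ∈ A, ∀ x ∈ T, ∀ y ∈ T, dist x y ≤ D

theorem DiamLE.smap {A : Set (Set X)} {D : ℝ} (h : DiamLE A D) (σ : X ≃ᵢ X) :
    DiamLE (smap σ A) D := by
  rintro _ ⟨T, hT, rfl⟩ _ ⟨x, hx, rfl⟩ _ ⟨y, hy, rfl⟩
  rw [σ.dist_eq]
  exact h T hT x hx y hy

theorem DiamLE.dist_le_of_mem_bt {A : Set (Set X)} {D : ℝ} (h : DiamLE A D) {T : Set X}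
    (hT : T ∈ A) {r : ℕ} {U : Set X} (hU : U ∈ bt A T r) {x y : X} (hx : x ∈ T) (hy : y ∈ U) :
    dist x y ≤ (r + 1) * D := by
  induction r generalizing U y with
  | zero =>
    obtain rfl := hU
    simpa using h U hT x hx y hy
  | succ r ih =>
    obtain ⟨hUA, W, hW, z, hzU, hzW⟩ := hU
    have h1 := ih hW hzW
    have h2 := h U hUA z hzU y hy
    have h3 := dist_triangle x z y
    push_cast
    linarith

/-- The tile `U` meets the closed ball of radius `R` around `o`. -/
def Meets (o : X) (R : ℝ) (U : Set X) : Prop := (U ∩ closedBall o R).Nonempty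

theorem Meets.mono {o : X} {R R' : ℝ} (hR : R ≤ R') {U : Set X} (h : Meets o R U) :
    Meets o R' U :=
  Nonempty.mono (inter_subset_inter_right _ (closedBall_subset_closedBall hR)) h

theorem meets_tmap {σ : X ≃ᵢ X} {o : X} {R : ℝ} {U : Set X} :
    Meets (σ o) R (tmap σ U) ↔ Meets o R U := by
  rw [Meets, Meets, ← σ.image_closedBall]
  exact inter_tmap_nonempty σ U _

theorem exists_forall_meets (o : X) {A : Set (Set X)} (hA : A.Finite) (hne : ∅ ∉ A) :
    ∃ R, ∀ U ∈ A, Meets o R U := by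
  induction A, hA using Set.Finite.induction_on with
  | empty => exact ⟨0, by simp⟩
  | @insert U A _ _ ih =>
    obtain ⟨R, hR⟩ := ih fun h => hne (mem_insert_of_mem _ h)
    obtain ⟨x, hx⟩ : U.Nonempty := nonempty_iff_ne_empty.2 fun h => hne (by simp [h])
    refine ⟨max R (dist x o), fun W hW => ?_⟩
    rcases hW with rfl | hW
    · exact ⟨x, hx, mem_closedBall.2 (le_max_right _ _)⟩
    · exact (hR W hW).mono (le_max_left _ _)

/-- The sets of tiles `A` and `B` have the same tiles meeting the closed ball of radius `R`
around `o`. -/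
def Agree (o : X) (R : ℝ) (A B : Set (Set X)) : Prop := ∀ U, Meets o R U → (U ∈ A ↔ U ∈ B)

theorem Agree.trans {o : X} {R : ℝ} {A B C : Set (Set X)} (h : Agree o R A B)
    (h' : Agree o R B C) : Agree o R A C :=
  fun U hU => (h U hU).trans (h' U hU)

theorem Agree.mono {o : X} {R R' : ℝ} (hR : R ≤ R') {A B : Set (Set X)} (h : Agree o R' A B) :
    Agree o R A B :=
  fun U hU => h U (hU.mono hR)

theorem Agree.smap {o : X} {R : ℝ} {A B : Set (Set X)} (h : Agree o R A B) (σ : X ≃ᵢ X) :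
    Agree (σ o) R (smap σ A) (smap σ B) := by
  intro U hU
  rw [← tmap_tmap_inv σ U, meets_tmap] at hU
  rw [mem_smap, mem_smap]
  exact h _ hU

theorem agree_of_bt_eq {o : X} {R : ℝ} {A B : Set (Set X)} (hA : ∅ ∉ A) {T : Set X} (hT : T ∈ A)
    (hcov : ⋃₀ A = univ) {r : ℕ} (hR : ∀ U ∈ A, Meets o R U → U ∈ bt A T r)
    (h : bt A T (r + 1) = bt B T (r + 1)) : Agree o R A B := by
  have hsub : bt A T (r + 1) ⊆ B := h.trans_subset fun U hU => hU.1
  intro U hU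
  constructor
  · exact fun hUA => hsub (bt_mono hA hT r.le_succ (hR U hUA hU))
  · intro hUB
    obtain ⟨p, hpU, hp⟩ := hU
    obtain ⟨W, hW, hpW⟩ : p ∈ ⋃₀ A := hcov ▸ mem_univ p
    have hWr := bt_subset_bt hA hT hsub r.le_succ (hR W hW ⟨p, hpW, hp⟩)
    have : U ∈ bt B T (r + 1) := ⟨hUB, W, hWr, p, hpU, hpW⟩
    rw [← h] at this
    exact this.1

theorem Agree.bt_eq {o : X} {R R' D : ℝ} {A B : Set (Set X)} (h : Agree o R' A B)
    (hA : DiamLE A D) (hD : 0 ≤ D) {T : Set X} (hTA : T ∈ A) (hT : Meets o R T) {r : ℕ}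
    (hr : R + (r + 1) * D ≤ R') : bt A T r = bt B T r := by
  induction r with
  | zero => rfl
  | succ r ih =>
    push_cast at hr
    have ih := ih (by linarith)
    ext U
    simp only [bt, ← ih, mem_ofPred_eq]
    refine and_congr_left ?_
    rintro ⟨W, hW, p, hpU, hpW⟩
    obtain ⟨x, hxT, hx⟩ := hT
    refine h U ⟨p, hpU, ?_⟩
    have h1 := hA.dist_le_of_mem_bt hTA hW hxT hpW
    have h2 := dist_triangle_left p o x
    rw [mem_closedBall] at hx ⊢
    linarith

end Tiles

section Tilings

variable {X : Type*} [MetricSpace X] {𝒯 : Set (Set X)}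

theorem PIso.symm {A B : Set (Set X)} {S T : Set X} (h : PIso ⊤ A S B T) : PIso ⊤ B T A S := by
  obtain ⟨σ, -, rfl, rfl⟩ := h
  exact ⟨σ⁻¹, trivial, smap_inv_smap σ A, tmap_inv_tmap σ S⟩

theorem PIso.trans {A B C : Set (Set X)} {S T U : Set X} (h : PIso ⊤ A S B T)
    (h' : PIso ⊤ B T C U) : PIso ⊤ A S C U := by
  obtain ⟨σ, -, rfl, rfl⟩ := h
  obtain ⟨τ, -, rfl, rfl⟩ := h'
  exact ⟨τ * σ, trivial, smap_mul τ σ A, tmap_mul τ σ S⟩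

theorem piso_smap (σ : X ≃ᵢ X) (A : Set (Set X)) (T : Set X) :
    PIso ⊤ A (tmap σ⁻¹ T) (smap σ A) T :=
  ⟨σ, trivial, rfl, tmap_tmap_inv σ T⟩

theorem IsTiling.finite_bt (h : IsTiling ⊤ 𝒯) {T : Set X} (hT : T ∈ 𝒯) (r : ℕ) :
    (bt 𝒯 T r).Finite := by
  cases r with
  | zero => exact finite_singleton T
  | succ r => exact ((h.2.2 (r + 1) (by omega)).1 T hT).1

theorem IsTiling.exists_diamLE (h : IsTiling ⊤ 𝒯) : ∃ D > 0, DiamLE 𝒯 D := by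
  obtain ⟨𝒜, hfin, hsub, h𝒜⟩ := (h.2.2 1 le_rfl).2.2
  obtain ⟨D, hD⟩ := (hfin.image diam).bddAbove
  refine ⟨max D 1, lt_max_of_lt_right one_pos, fun T hT => ?_⟩
  obtain ⟨S, hS, σ, -, -, rfl⟩ := h𝒜 T hT
  rintro _ ⟨x, hx, rfl⟩ _ ⟨y, hy, rfl⟩
  rw [σ.dist_eq]
  exact (dist_le_diam_of_mem (h.1 S (hsub hS)).2 hx hy).trans
    (le_max_of_le_left (hD (mem_image_of_mem _ hS)))

theorem IsTiling.finite_meets [ProperSpace X] (h : IsTiling ⊤ 𝒯) (o : X) (R : ℝ) :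
    {T | T ∈ 𝒯 ∧ Meets o R T}.Finite := by
  have hlf : LocallyFinite (fun T : 𝒯 => (T : Set X)) := by
    intro x
    obtain ⟨T, hT, hx⟩ : x ∈ ⋃₀ 𝒯 := h.2.1 ▸ mem_univ x
    have h1 := ((h.2.2 1 le_rfl).1 T hT).2
    refine ⟨interior (⋃₀ bt 𝒯 T 1), isOpen_interior.mem_nhds (h1 ⟨T, rfl, hx⟩), ?_⟩
    refine Finite.of_finite_image ((h.finite_bt hT 2).subset ?_) Subtype.val_injective.injOn
    rintro _ ⟨U, ⟨p, hpU, hp⟩, rfl⟩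
    obtain ⟨W, hW, hpW⟩ := interior_subset hp
    exact ⟨U.2, W, hW, p, hpU, hpW⟩
  refine ((hlf.finite_nonempty_inter_compact (isCompact_closedBall o R)).image
    Subtype.val).subset ?_
  rintro T ⟨hT, hm⟩
  exact ⟨⟨T, hT⟩, hm, rfl⟩

theorem IsTiling.exists_mem_bt [PreconnectedSpace X] (h : IsTiling ⊤ 𝒯) (hne : ∅ ∉ 𝒯)
    {S T : Set X} (hS : S ∈ 𝒯) (hT : T ∈ 𝒯) : ∃ r, T ∈ bt 𝒯 S r := by
  let C : Set X → Set X := fun T => ⋃ r, ⋃₀ bt 𝒯 T r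
  have hopen : ∀ T ∈ 𝒯, IsOpen (C T) := by
    intro T hT
    refine isOpen_iff_mem_nhds.2 fun x hx => ?_
    obtain ⟨r, hr⟩ := mem_iUnion.1 hx
    have h1 := ((h.2.2 (r + 1) (by omega)).1 T hT).2 hr
    exact Filter.mem_of_superset (mem_interior_iff_mem_nhds.1 h1)
      (subset_iUnion (fun r => ⋃₀ bt 𝒯 T r) (r + 1))
  have hself : ∀ T, T ⊆ C T := fun T x hx => mem_iUnion.2 ⟨0, T, rfl, hx⟩
  have hclosed : IsClosed (C S) := by
    rw [← isOpen_compl_iff, isOpen_iff_mem_nhds]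
    intro x hx
    obtain ⟨U, hU, hxU⟩ : x ∈ ⋃₀ 𝒯 := h.2.1 ▸ mem_univ x
    refine Filter.mem_of_superset ((hopen U hU).mem_nhds (hself U hxU)) fun y hyU hyS => hx ?_
    obtain ⟨a, W, hW, hyW⟩ := mem_iUnion.1 hyU
    obtain ⟨b, W', hW', hyW'⟩ := mem_iUnion.1 hyS
    obtain ⟨c, hc⟩ := exists_mem_bt_symm hU hW
    have h1 : W ∈ bt 𝒯 S (b + 1) := ⟨bt_subset hU a hW, W', hW', y, hyW, hyW'⟩
    exact mem_iUnion.2 ⟨b + 1 + c, U, bt_trans h1 hc, hxU⟩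
  have hnonempty : ∀ T ∈ 𝒯, T.Nonempty := fun T hT =>
    nonempty_iff_ne_empty.2 fun h => hne (h ▸ hT)
  have huniv : C S = univ :=
    IsClopen.eq_univ ⟨hclosed, hopen S hS⟩ ((hnonempty S hS).mono (hself S))
  obtain ⟨x, hx⟩ := hnonempty T hT
  obtain ⟨r, W, hW, hxW⟩ := mem_iUnion.1 (huniv ▸ mem_univ x : x ∈ C S)
  exact ⟨r + 1, hT, W, hW, x, hx, hxW⟩

theorem IsTiling.exists_forall_meets_mem_bt [ProperSpace X] [PreconnectedSpace X]
    (h : IsTiling ⊤ 𝒯) (hne : ∅ ∉ 𝒯) {T : Set X} (hT : T ∈ 𝒯) (o : X) (R : ℝ) :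
    ∃ r, ∀ U ∈ 𝒯, Meets o R U → U ∈ bt 𝒯 T r := by
  have h1 : ∀ U : Set X, ∃ r, U ∈ 𝒯 → U ∈ bt 𝒯 T r := fun U => by
    by_cases hU : U ∈ 𝒯
    · obtain ⟨r, hr⟩ := h.exists_mem_bt hne hT hU
      exact ⟨r, fun _ => hr⟩
    · exact ⟨0, fun h => absurd h hU⟩
  choose f hf using h1
  obtain ⟨r, hr⟩ := ((h.finite_meets o R).image f).bddAbove
  exact ⟨r, fun U hU hm => bt_mono hne hT (hr (mem_image_of_mem f ⟨hU, hm⟩)) (hf U hU)⟩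

/-- In a tiling, copies of balls inside the tiling are balls. -/
theorem IsTiling.ncard_bt_eq (h : IsTiling ⊤ 𝒯) (hne : ∅ ∉ 𝒯) {T : Set X} (hT : T ∈ 𝒯) {r : ℕ}
    {σ : X ≃ᵢ X} (hσ : smap σ (bt 𝒯 T (r + 1)) ⊆ 𝒯) :
    smap σ (bt 𝒯 T (r + 1)) ⊆ bt 𝒯 (tmap σ T) (r + 1) ∧
      (bt 𝒯 (tmap σ T) (r + 1)).ncard = (bt 𝒯 T (r + 1)).ncard := by
  have hσT : tmap σ T ∈ 𝒯 := hσ (tmap_mem_smap.2 (self_mem_bt hne hT _))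
  have hsub : smap σ (bt 𝒯 T (r + 1)) ⊆ bt 𝒯 (tmap σ T) (r + 1) := by
    rw [← bt_smap] at hσ ⊢
    exact bt_subset_bt (empty_notMem_smap hne σ) (tmap_mem_smap.2 hT) hσ le_rfl
  obtain ⟨τ, -, h1, -⟩ :=
    (h.2.2 (r + 1) (by omega)).2.1 T hT (tmap σ T) hσT ⟨σ, trivial, hsub, rfl⟩
  exact ⟨hsub, by rw [← h1, ncard_smap]⟩

theorem IsTiling.smap_bt_eq (h : IsTiling ⊤ 𝒯) (hne : ∅ ∉ 𝒯) {T : Set X} (hT : T ∈ 𝒯) {r : ℕ}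
    {σ : X ≃ᵢ X} (hσ : smap σ (bt 𝒯 T (r + 1)) ⊆ 𝒯) :
    smap σ (bt 𝒯 T (r + 1)) = bt 𝒯 (tmap σ T) (r + 1) := by
  obtain ⟨h1, h2⟩ := h.ncard_bt_eq hne hT hσ
  have hσT : tmap σ T ∈ 𝒯 := hσ (tmap_mem_smap.2 (self_mem_bt hne hT _))
  exact eq_of_subset_of_ncard_le h1 (by rw [ncard_smap, h2]) (h.finite_bt hσT _)

theorem TilingLIP.empty_notMem [Nonempty X] (h : TilingLIP ⊤ 𝒯) : ∅ ∉ 𝒯 := by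
  intro hmem
  obtain ⟨k, hk, h1⟩ := h {∅} (singleton_subset_iff.2 hmem)
    (by rintro S rfl T rfl; exact ⟨0, rfl⟩) (finite_singleton _)
  obtain ⟨σ, -, hσ⟩ := h1 ∅ hmem
  obtain ⟨j, rfl⟩ := Nat.exists_eq_succ_of_ne_zero (by omega : k ≠ 0)
  have h2 : ∀ j U, U ∉ bt 𝒯 ∅ (j + 1) := by
    intro j
    induction j with
    | zero => rintro U ⟨-, W, rfl, h⟩; simp at h
    | succ j ih => rintro U ⟨-, W, hW, -⟩; exact ih W hW
  exact h2 j _ (hσ ⟨∅, rfl, rfl⟩)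

theorem TSub.empty_notMem {𝒯' : Set (Set X)} (h : TSub ⊤ 𝒯' 𝒯) (hne : ∅ ∉ 𝒯) : ∅ ∉ 𝒯' := by
  intro hmem
  obtain ⟨ℱ, hℱ, -, σ, -, rfl⟩ := h {∅} (singleton_subset_iff.2 hmem)
    (by rintro S rfl T rfl; exact ⟨0, rfl⟩) (finite_singleton _)
  exact hne (hℱ ⟨∅, rfl, by simp [tmap]⟩)

/-- A tiling whose patches occur in `𝒯` and conversely agrees on every ball with a copy of `𝒯`. -/
theorem exists_agree_of_tLocIso [ProperSpace X] [PreconnectedSpace X] {𝒯' : Set (Set X)}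
    (h : IsTiling ⊤ 𝒯) (h' : IsTiling ⊤ 𝒯') (hne : ∅ ∉ 𝒯) (hloc : TLocIso ⊤ 𝒯 𝒯') (o : X)
    (R : ℝ) : ∃ σ : X ≃ᵢ X, Agree o R 𝒯' (smap σ 𝒯) := by
  have hne' := hloc.2.empty_notMem hne
  obtain ⟨T, hT, -⟩ : o ∈ ⋃₀ 𝒯' := h'.2.1 ▸ mem_univ o
  obtain ⟨r, hr⟩ := h'.exists_forall_meets_mem_bt hne' hT o R
  obtain ⟨_, hσ, -, σ, -, rfl⟩ :=
    hloc.2 _ (bt_subset hT (r + 1)) (isPatch_bt hne' hT _) (h'.finite_bt hT _)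
  have hσT : tmap σ T ∈ 𝒯 := hσ (tmap_mem_smap.2 (self_mem_bt hne' hT _))
  have hsub : smap σ (bt 𝒯' T (r + 1)) ⊆ bt 𝒯 (tmap σ T) (r + 1) := by
    rw [← bt_smap] at hσ ⊢
    exact bt_subset_bt (empty_notMem_smap hne' σ) (tmap_mem_smap.2 hT) hσ le_rfl
  obtain ⟨_, hτ, -, τ, -, rfl⟩ :=
    hloc.1 _ (bt_subset hσT (r + 1)) (isPatch_bt hne hσT _) (h.finite_bt hσT _)
  have hτT : tmap (τ * σ) T ∈ 𝒯' := by
    rw [tmap_mul]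
    exact hτ (tmap_mem_smap.2 (self_mem_bt hne hσT _))
  have hsub2 : smap τ (bt 𝒯 (tmap σ T) (r + 1)) ⊆ bt 𝒯' (tmap (τ * σ) T) (r + 1) := by
    rw [tmap_mul]
    rw [← bt_smap] at hτ ⊢
    exact bt_subset_bt (empty_notMem_smap hne τ) (tmap_mem_smap.2 hσT) hτ le_rfl
  have hcard := (h'.ncard_bt_eq hne' hT (σ := τ * σ) (r := r) (by
    rw [smap_mul]
    exact (smap_mono τ hsub).trans hτ)).2
  have hle := ncard_le_ncard hsub2 (h'.finite_bt hτT _)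
  rw [hcard, ncard_smap] at hle
  have heq := eq_of_subset_of_ncard_le hsub (by rwa [ncard_smap]) (h.finite_bt hσT _)
  refine ⟨σ⁻¹, agree_of_bt_eq hne' hT h'.2.1 hr ?_⟩
  rw [bt_smap', inv_inv, ← heq, smap_inv_smap]

section Limit

variable {𝒯' : Set (Set X)} {o : X}

theorem exists_forall_bt_eq (h : IsTiling ⊤ 𝒯)
    (hag : ∀ R, ∃ σ : X ≃ᵢ X, Agree o R (smap σ 𝒯) 𝒯') (R : ℝ) (r : ℕ) :
    ∃ σ : X ≃ᵢ X, ∀ T ∈ 𝒯', Meets o R T →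
      tmap σ⁻¹ T ∈ 𝒯 ∧ ∀ j ≤ r, bt 𝒯' T j = smap σ (bt 𝒯 (tmap σ⁻¹ T) j) := by
  obtain ⟨D, hD, hdiam⟩ := h.exists_diamLE
  obtain ⟨σ, hσ⟩ := hag (R + (r + 1) * D)
  refine ⟨σ, fun T hT hm => ?_⟩
  have hTσ : T ∈ smap σ 𝒯 := (hσ T (hm.mono (le_add_of_nonneg_right (by positivity)))).2 hT
  refine ⟨mem_smap.1 hTσ, fun j hj => ?_⟩
  rw [← bt_smap']
  refine (hσ.bt_eq (hdiam.smap σ) hD.le hTσ hm ?_).symm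
  gcongr

theorem isTiling_of_agree (h : IsTiling ⊤ 𝒯) (hne' : ∅ ∉ 𝒯')
    (hag : ∀ R, ∃ σ : X ≃ᵢ X, Agree o R (smap σ 𝒯) 𝒯') : IsTiling ⊤ 𝒯' := by
  have hpair : ∀ S ∈ 𝒯', ∀ T ∈ 𝒯', ∀ r : ℕ, ∃ σ : X ≃ᵢ X, (tmap σ⁻¹ S ∈ 𝒯 ∧ ∀ j ≤ r,
      bt 𝒯' S j = smap σ (bt 𝒯 (tmap σ⁻¹ S) j)) ∧ tmap σ⁻¹ T ∈ 𝒯 ∧ ∀ j ≤ r,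
      bt 𝒯' T j = smap σ (bt 𝒯 (tmap σ⁻¹ T) j) := by
    intro S hS T hT r
    obtain ⟨R, hR⟩ := exists_forall_meets o (A := {S, T}) (by simp)
      (by rintro (h | h) <;> exact hne' (h ▸ ‹_›))
    obtain ⟨σ, hσ⟩ := exists_forall_bt_eq h hag R r
    exact ⟨σ, hσ S hS (hR S (by simp)), hσ T hT (hR T (by simp))⟩
  have hsingle : ∀ T ∈ 𝒯', ∀ r : ℕ, ∃ σ : X ≃ᵢ X, tmap σ⁻¹ T ∈ 𝒯 ∧ ∀ j ≤ r,
      bt 𝒯' T j = smap σ (bt 𝒯 (tmap σ⁻¹ T) j) := fun T hT r =>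
    let ⟨σ, hσ, _⟩ := hpair T hT T hT r
    ⟨σ, hσ⟩
  refine ⟨fun T hT => ?_, ?_, fun r hr => ⟨fun T hT => ?_, fun S hS T hT hle => ?_, ?_⟩⟩
  · obtain ⟨σ, hσ, -⟩ := hsingle T hT 0
    obtain ⟨h1, h2⟩ := h.1 _ hσ
    rw [← tmap_tmap_inv σ T]
    exact ⟨σ.toHomeomorph.isClosedMap _ h1, σ.isometry.lipschitz.isBounded_image h2⟩
  · refine eq_univ_of_forall fun x => ?_
    obtain ⟨σ, hσ⟩ := hag (dist x o)
    obtain ⟨T, hT, hx⟩ : x ∈ ⋃₀ smap σ 𝒯 := by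
      rw [sUnion_smap, h.2.1, image_univ, σ.surjective.range_eq]
      trivial
    exact ⟨T, (hσ T ⟨x, hx, mem_closedBall.2 le_rfl⟩).1 hT, hx⟩
  · obtain ⟨σ, hσ, hbt⟩ := hsingle T hT r
    obtain ⟨h1, h2⟩ := (h.2.2 r hr).1 _ hσ
    rw [hbt r le_rfl, hbt (r - 1) (Nat.sub_le r 1), sUnion_smap, sUnion_smap]
    refine ⟨h1.image _, ?_⟩
    have := σ.toHomeomorph.image_interior (⋃₀ bt 𝒯 (tmap σ⁻¹ T) r)
    exact (image_mono h2).trans this.subset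
  · obtain ⟨σ, ⟨hS', hbS⟩, hT', hbT⟩ := hpair S hS T hT r
    rw [hbS r le_rfl, hbT r le_rfl] at hle ⊢
    refine (piso_smap σ _ S).symm.trans (((h.2.2 r hr).2.1 _ hS' _ hT' ?_).trans (piso_smap σ _ T))
    obtain ⟨τ, -, h1, h2⟩ := hle
    refine ⟨σ⁻¹ * τ * σ, trivial, ?_, ?_⟩
    · rw [smap_mul, smap_mul]
      exact (smap_mono σ⁻¹ h1).trans (smap_inv_smap σ _).subset
    · rw [tmap_mul, tmap_mul, tmap_tmap_inv, h2]
  · obtain ⟨𝒜, hfin, -, h𝒜⟩ := (h.2.2 r hr).2.2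
    have hclass : ∀ T ∈ 𝒯', ∃ S ∈ 𝒜, PIso ⊤ (bt 𝒯 S r) S (bt 𝒯' T r) T := by
      intro T hT
      obtain ⟨σ, hσ, hbt⟩ := hsingle T hT r
      obtain ⟨S, hS, hST⟩ := h𝒜 _ hσ
      exact ⟨S, hS, hST.trans (by rw [hbt r le_rfl]; exact piso_smap σ _ T)⟩
    have hrep : ∀ S : Set X, ∃ T : Set X, (∃ T' ∈ 𝒯', PIso ⊤ (bt 𝒯 S r) S (bt 𝒯' T' r) T') →
        T ∈ 𝒯' ∧ PIso ⊤ (bt 𝒯 S r) S (bt 𝒯' T r) T := fun S => by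
      by_cases hex : ∃ T' ∈ 𝒯', PIso ⊤ (bt 𝒯 S r) S (bt 𝒯' T' r) T'
      · obtain ⟨T, hT⟩ := hex
        exact ⟨T, fun _ => hT⟩
      · exact ⟨∅, fun h => absurd h hex⟩
    choose f hf using hrep
    refine ⟨f '' 𝒜 ∩ 𝒯', (hfin.image f).inter_of_left _, inter_subset_right, fun T hT => ?_⟩
    obtain ⟨S, hS, hST⟩ := hclass T hT
    obtain ⟨h1, h2⟩ := hf S ⟨T, hT, hST⟩
    exact ⟨f S, ⟨mem_image_of_mem f hS, h1⟩, h2.symm.trans hST⟩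

theorem tLocIso_of_agree (h : IsTiling ⊤ 𝒯) (hlip : TilingLIP ⊤ 𝒯) (hne' : ∅ ∉ 𝒯')
    (hag : ∀ R, ∃ σ : X ≃ᵢ X, Agree o R (smap σ 𝒯) 𝒯') : TLocIso ⊤ 𝒯 𝒯' := by
  constructor
  · intro ℰ hℰ hpatch hfin
    obtain ⟨k, -, hk⟩ := hlip ℰ hℰ hpatch hfin
    obtain ⟨T, hT, -⟩ : o ∈ ⋃₀ 𝒯' := (isTiling_of_agree h hne' hag).2.1 ▸ mem_univ o
    obtain ⟨R, hR⟩ := exists_forall_meets o (A := {T}) (by simp)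
      (by rintro h; exact hne' (h ▸ hT))
    obtain ⟨σ, hσ⟩ := exists_forall_bt_eq h hag R k
    obtain ⟨hT', hbt⟩ := hσ T hT (hR T rfl)
    obtain ⟨τ, -, hτ⟩ := hk _ hT'
    refine ⟨smap (σ * τ) ℰ, ?_, hpatch.smap _, σ * τ, trivial, rfl⟩
    rw [smap_mul]
    refine (smap_mono σ hτ).trans ?_
    rw [← hbt k le_rfl]
    exact bt_subset hT k
  · intro ℰ hℰ hpatch hfin
    obtain ⟨R, hR⟩ := exists_forall_meets o hfin fun h => hne' (hℰ h)
    obtain ⟨σ, hσ⟩ := hag R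
    refine ⟨smap σ⁻¹ ℰ, ?_, hpatch.smap _, σ⁻¹, trivial, rfl⟩
    have : ℰ ⊆ smap σ 𝒯 := fun U hU => (hσ U (hR U hU)).2 (hℰ hU)
    exact (smap_mono σ⁻¹ this).trans (smap_inv_smap σ _).subset

end Limit

end Tilings

section Symmetries

variable {X : Type*} [MetricSpace X]

/-- The isometries leaving a set of tiles globally invariant. -/
def symGroup (A : Set (Set X)) : Subgroup (X ≃ᵢ X) where
  carrier := {γ | smap γ A = A}
  mul_mem' {γ δ} (hγ : smap γ A = A) (hδ : smap δ A = A) := by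
    change smap (γ * δ) A = A
    rw [smap_mul, hδ, hγ]
  one_mem' := smap_one A
  inv_mem' {γ} (hγ : smap γ A = A) := by
    change smap γ⁻¹ A = A
    nth_rw 1 [← hγ]
    exact smap_inv_smap γ A

theorem mem_symGroup {A : Set (Set X)} {γ : X ≃ᵢ X} : γ ∈ symGroup A ↔ smap γ A = A := Iff.rfl

theorem smap_eq_self_iff {A : Set (Set X)} {γ : X ≃ᵢ X} :
    smap γ A = A ↔ ∀ U, tmap γ U ∈ A ↔ U ∈ A := by
  constructor
  · intro h U
    nth_rw 1 [← h]
    exact tmap_mem_smap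
  · intro h
    ext U
    rw [mem_smap, ← h, tmap_tmap_inv]

theorem Meets.tmap_add {o : X} {R K : ℝ} {U : Set X} (hU : Meets o R U) {γ : X ≃ᵢ X}
    (hγ : dist (γ o) o ≤ K) : Meets o (R + K) (tmap γ U) := by
  obtain ⟨x, hx, hxo⟩ := hU
  refine ⟨γ x, mem_image_of_mem γ hx, ?_⟩
  rw [mem_closedBall] at hxo ⊢
  have := dist_triangle (γ x) (γ o) o
  rw [γ.dist_eq] at this
  linarith

theorem smap_eq_self_of_agree {A : Set (Set X)} {γ : X ≃ᵢ X} {o : X}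
    (h : ∀ R, ∃ B, Agree o R A B ∧ smap γ B = B) : smap γ A = A := by
  rw [smap_eq_self_iff]
  intro U
  rcases U.eq_empty_or_nonempty with rfl | hU
  · simp [tmap]
  obtain ⟨R, hR⟩ := exists_forall_meets o (A := {U, tmap γ U}) (by simp) (by
    rintro (h | h)
    · exact hU.ne_empty h.symm
    · exact (hU.image γ).ne_empty (mem_singleton_iff.1 h).symm)
  obtain ⟨B, hB, hγ⟩ := h R
  rw [hB U (hR U (by simp)), hB _ (hR (tmap γ U) (by simp))]
  exact smap_eq_self_iff.1 hγ U

/-- If `γ` does not leave `A` invariant, then this is visible in some ball. -/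
theorem exists_forall_agree_smap_ne {A : Set (Set X)} {γ : X ≃ᵢ X} (o : X)
    (h : smap γ A ≠ A) : ∃ R, ∀ B, Agree o R A B → smap γ B ≠ B := by
  by_contra! hcon
  exact h (smap_eq_self_of_agree hcon)

theorem pow_apply_mem {γ : X ≃ᵢ X} {T : Set X} (hT : tmap γ T = T) {x : X} (hx : x ∈ T) (k : ℕ) :
    (γ ^ k) x ∈ T := by
  induction k with
  | zero => simpa using hx
  | succ k ih =>
    rw [pow_succ', ← hT]
    exact mem_image_of_mem γ ih

theorem exists_agree_forall_smap_ne {𝒯 : Set (Set X)} {o : X}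
    (hdet : ∀ (σ γ : X ≃ᵢ X) (R : ℝ), γ ≠ 1 → ∃ τ : X ≃ᵢ X,
      Agree o R (smap σ 𝒯) (smap τ 𝒯) ∧ smap γ (smap τ 𝒯) ≠ smap τ 𝒯)
    {F : Set (X ≃ᵢ X)} (hF : F.Finite) (h1 : 1 ∉ F) (σ : X ≃ᵢ X) (R : ℝ) :
    ∃ (τ : X ≃ᵢ X) (R' : ℝ), R + 1 ≤ R' ∧ Agree o R (smap σ 𝒯) (smap τ 𝒯) ∧
      ∀ γ ∈ F, ∀ B, Agree o R' (smap τ 𝒯) B → smap γ B ≠ B := by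
  induction F, hF using Set.Finite.induction_on with
  | empty => exact ⟨σ, R + 1, le_rfl, fun U _ => Iff.rfl, by simp⟩
  | @insert γ F _ _ ih =>
    obtain ⟨τ, R', hR', hag, hτ⟩ := ih fun h => h1 (mem_insert_of_mem _ h)
    obtain ⟨τ', hag', hγ⟩ := hdet τ γ R' fun h => h1 (h ▸ mem_insert _ _)
    obtain ⟨R₁, hR₁⟩ := exists_forall_agree_smap_ne o hγ
    refine ⟨τ', max R' R₁, le_max_of_le_left hR',
      hag.trans (hag'.mono (by linarith)), fun δ hδ B hB => ?_⟩
    rcases hδ with rfl | hδ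
    · exact hR₁ B (hB.mono (le_max_right _ _))
    · exact hτ δ hδ B (hag'.trans (hB.mono (le_max_left _ _)))

end Symmetries

section Euclidean

variable {V : Type*} [NormedAddCommGroup V] [InnerProductSpace ℝ V]

theorem pow_apply_zero_of_lin_eq_one {γ : V ≃ᵢ V} (h : lin γ = 1) (k : ℕ) :
    (γ ^ k) 0 = k • γ 0 := by
  induction k with
  | zero => simp
  | succ k ih =>
    have h1 := lin_apply γ ((γ ^ k) 0)
    rw [h, one_apply_eq_self, eq_sub_iff_add_eq] at h1
    rw [pow_succ', succ_nsmul, ← ih, h1]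
    rfl

/-- An isometry which fixes all the tiles in a large ball is trivial. -/
theorem eq_one_of_forall_tmap_eq {A : Set (Set V)} {D : ℝ} (hcov : ⋃₀ A = univ)
    (hA : DiamLE A D) (hD : 0 < D) {γ : V ≃ᵢ V}
    (hγ : ∀ T ∈ A, Meets 0 (8 * D) T → tmap γ T = T) : γ = 1 := by
  have hdist : ∀ (k : ℕ) (x : V), ‖x‖ ≤ 8 * D → ‖(γ ^ k) x - x‖ ≤ D := by
    intro k x hx
    obtain ⟨T, hT, hxT⟩ : x ∈ ⋃₀ A := hcov ▸ mem_univ x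
    rw [← dist_eq_norm]
    exact hA T hT _ (pow_apply_mem (hγ T hT ⟨x, hxT, mem_closedBall_zero_iff.2 hx⟩) hxT k) x hxT
  have hzero : ∀ k : ℕ, ‖(γ ^ k) 0‖ ≤ D := fun k => by
    simpa using hdist k 0 (by simpa using hD.le)
  have hlin : lin γ = 1 := by
    refine eq_one_of_forall_norm_pow_sub_one_le fun k => ?_
    rw [← lin_pow]
    refine ContinuousLinearMap.opNorm_le_of_unit_norm (by norm_num) fun x hx => ?_
    have hy : ‖(8 * D) • x‖ = 8 * D := by
      rw [norm_smul, hx, mul_one, Real.norm_of_nonneg (by positivity)]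
    have h1 : ‖(lin (γ ^ k) - 1) ((8 * D) • x)‖ ≤ 2 * D := by
      have h2 : (lin (γ ^ k) - 1) ((8 * D) • x) =
          ((γ ^ k) ((8 * D) • x) - (8 * D) • x) - (γ ^ k) 0 := by
        rw [sub_apply, lin_apply, one_apply_eq_self]
        abel
      rw [h2]
      refine (norm_sub_le _ _).trans ?_
      linarith [hdist k _ hy.le, hzero k]
    rw [map_smul, norm_smul, Real.norm_of_nonneg (by positivity)] at h1
    nlinarith
  refine eq_one_of_lin_eq_one hlin (x := 0) (norm_le_zero_iff.1 ?_)
  by_contra! hpos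
  obtain ⟨k, hk⟩ := exists_nat_gt (D / ‖γ 0‖)
  have h1 := hzero k
  rw [pow_apply_zero_of_lin_eq_one hlin, ← Nat.cast_smul_eq_nsmul ℝ, norm_smul,
    Real.norm_natCast] at h1
  rw [div_lt_iff₀ hpos] at hk
  linarith

/-- Only finitely many isometries with bounded displacement at the origin map all the tiles near
the origin to tiles. -/
theorem finite_setOf_tmap_mem {A : Set (Set V)} {D : ℝ} (hcov : ⋃₀ A = univ)
    (hA : DiamLE A D) (hD : 0 < D) (hfin : ∀ R, {T | T ∈ A ∧ Meets 0 R T}.Finite) (K : ℝ) :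
    {γ : V ≃ᵢ V | dist (γ 0) 0 ≤ K ∧ ∀ T ∈ A, Meets 0 (8 * D) T → tmap γ T ∈ A}.Finite := by
  have := (hfin (8 * D)).to_subtype
  refine Finite.of_injOn (f := fun γ (T : {T | T ∈ A ∧ Meets 0 (8 * D) T}) => tmap γ (T : Set V))
    (t := pi univ fun _ => {T | T ∈ A ∧ Meets 0 (8 * D + K) T}) ?_ ?_
    (Finite.pi fun _ => hfin (8 * D + K))
  · rintro γ ⟨hK, hγ⟩ T -
    exact ⟨hγ T T.2.1 T.2.2, T.2.2.tmap_add hK⟩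
  · intro γ _ δ _ h
    have h1 : δ⁻¹ * γ = 1 := eq_one_of_forall_tmap_eq hcov hA hD fun T hT hm => by
      have h2 : tmap γ T = tmap δ T := congrFun h ⟨T, hT, hm⟩
      rw [tmap_mul, h2, tmap_inv_tmap]
    exact (inv_mul_eq_one.1 h1).symm

variable [FiniteDimensional ℝ V] {𝒯 𝒯' : Set (Set V)}

theorem IsTiling.finite_setOf_tmap_mem (h : IsTiling ⊤ 𝒯) {D : ℝ} (hdiam : DiamLE 𝒯 D)
    (hD : 0 < D) (σ : V ≃ᵢ V) (K : ℝ) :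
    {γ : V ≃ᵢ V | dist (γ 0) 0 ≤ K ∧
      ∀ T ∈ smap σ 𝒯, Meets 0 (8 * D) T → tmap γ T ∈ smap σ 𝒯}.Finite := by
  have := FiniteDimensional.proper_real V
  refine Paper.finite_setOf_tmap_mem ?_ (hdiam.smap σ) hD (fun R => ?_) K
  · rw [sUnion_smap, h.2.1, image_univ, σ.surjective.range_eq]
  · refine ((h.finite_meets (σ⁻¹ 0) R).image (tmap σ)).subset ?_
    rintro _ ⟨⟨T, hT, rfl⟩, hm⟩
    refine ⟨T, ⟨hT, (meets_tmap (σ := σ)).1 ?_⟩, rfl⟩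
    rwa [show σ (σ⁻¹ 0) = 0 from σ.apply_symm_apply 0]

theorem eq_one_of_smap_eq_of_tLocIso_tRigid (h : IsTiling ⊤ 𝒯) (h' : IsTiling ⊤ 𝒯')
    (hne : ∅ ∉ 𝒯) (hrigid : TRigid ⊤ 𝒯') (hloc : TLocIso ⊤ 𝒯 𝒯') {t : V ≃ᵢ V} (ht : lin t = 1)
    (hinv : smap t 𝒯 = 𝒯) : t = 1 := by
  have := FiniteDimensional.proper_real V
  by_contra hne1
  obtain ⟨D, hD, hdiam⟩ := h'.exists_diamLE
  choose σ hσ using fun n : ℕ => exists_agree_of_tLocIso h h' hne hloc 0 n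
  let τ : ℕ → V ≃ᵢ V := fun n => σ n * t * (σ n)⁻¹
  have hτ : ∀ n, smap (τ n) (smap (σ n) 𝒯) = smap (σ n) 𝒯 := fun n => by
    rw [smap_mul, smap_mul, smap_inv_smap, hinv]
  have hdist : ∀ n, dist (τ n 0) 0 ≤ ‖t 0‖ := fun n => by
    have h1 := lin_apply t ((σ n)⁻¹ 0)
    rw [ht, one_apply_eq_self] at h1
    have h2 : dist (τ n 0) (σ n ((σ n)⁻¹ 0)) = dist (t ((σ n)⁻¹ 0)) ((σ n)⁻¹ 0) :=
      (σ n).dist_eq _ _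
    rw [show σ n ((σ n)⁻¹ 0) = 0 from (σ n).apply_symm_apply 0] at h2
    rw [h2, dist_eq_norm, sub_eq_of_eq_add' (eq_sub_iff_add_eq.1 h1).symm]
  have hfin := h'.finite_setOf_tmap_mem hdiam hD 1 ‖t 0‖
  rw [smap_one] at hfin
  have hev : ∀ᶠ n in Filter.atTop, τ n ∈ {γ : V ≃ᵢ V | dist (γ 0) 0 ≤ ‖t 0‖ ∧
      ∀ T ∈ 𝒯', Meets 0 (8 * D) T → tmap γ T ∈ 𝒯'} := by
    filter_upwards [tendsto_natCast_atTop_atTop.eventually_ge_atTop (8 * D + ‖t 0‖)] with n hn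
    refine ⟨hdist n, fun T hT hm => ?_⟩
    rw [hσ n _ ((hm.tmap_add (hdist n)).mono hn), smap_eq_self_iff.1 (hτ n)]
    exact (hσ n T (hm.mono (by linarith [norm_nonneg (t 0)]))).1 hT
  obtain ⟨γ, -, hγ⟩ : ∃ γ ∈ {γ : V ≃ᵢ V | dist (γ 0) 0 ≤ ‖t 0‖ ∧
      ∀ T ∈ 𝒯', Meets 0 (8 * D) T → tmap γ T ∈ 𝒯'}, ∃ᶠ n in Filter.atTop, τ n = γ := by
    by_contra! hcon
    have h1 := (Filter.eventually_all_finite hfin).2 hcon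
    obtain ⟨n, h2, h3⟩ := (h1.and hev).exists
    exact h2 _ h3 rfl
  have hγ1 : γ = 1 := by
    refine hrigid γ trivial (smap_eq_self_of_agree (o := 0) fun R => ?_)
    obtain ⟨n, rfl, hn⟩ :=
      (hγ.and_eventually (tendsto_natCast_atTop_atTop.eventually_ge_atTop R)).exists
    exact ⟨_, (hσ n).mono hn, hτ n⟩
  obtain ⟨n, hn⟩ := hγ.exists
  exact hne1 (conj_eq_one_iff.1 (hn.trans hγ1))

/-- If all copies of `𝒯` with a given local pattern are invariant under a given nontrivial
isometry, then `𝒯` is invariant under a nontrivial translation. -/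
theorem exists_translation_of_forall_agree (h : IsTiling ⊤ 𝒯) (hlip : TilingLIP ⊤ 𝒯)
    {σ γ : V ≃ᵢ V} {R : ℝ} (hγ : γ ≠ 1) (hdet : ∀ τ : V ≃ᵢ V,
      Agree 0 R (smap σ 𝒯) (smap τ 𝒯) → smap γ (smap τ 𝒯) = smap τ 𝒯) :
    ∃ g : V ≃ᵢ V, g ≠ 1 ∧ lin g = 1 ∧ smap g 𝒯 = 𝒯 := by
  have := FiniteDimensional.proper_real V
  have hne := hlip.empty_notMem
  obtain ⟨D, hD, hdiam⟩ := h.exists_diamLE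
  obtain ⟨T, hT, y, hy⟩ : ∃ T ∈ 𝒯, T.Nonempty := by
    obtain ⟨T, hT, h0⟩ : (0 : V) ∈ ⋃₀ 𝒯 := h.2.1 ▸ mem_univ 0
    exact ⟨T, hT, 0, h0⟩
  obtain ⟨r, hr⟩ := h.exists_forall_meets_mem_bt hne hT (σ⁻¹ 0) R
  obtain ⟨k, -, hk⟩ :=
    hlip _ (bt_subset hT (r + 1)) (isPatch_bt hne hT _) (h.finite_bt hT _)
  suffices ∃ g ∈ symGroup 𝒯, g ≠ 1 ∧ lin g = 1 by
    obtain ⟨g, hg, hg1, hgl⟩ := this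
    exact ⟨g, hg1, hgl, hg⟩
  refine exists_translation_mem (τ := σ⁻¹ * γ * σ)
    (C := dist ((σ⁻¹ * γ * σ) y) y + 2 * ((k + 1) * D)) ?_ ?_ ?_
  · intro K
    refine (h.finite_setOf_tmap_mem hdiam hD 1 K).subset ?_
    rintro γ ⟨hγ, hK⟩
    rw [smap_one]
    exact ⟨hK, fun T hT _ => (smap_eq_self_iff.1 hγ T).2 hT⟩
  · intro h1
    refine hγ (conj_eq_one_iff (a := σ⁻¹).1 ?_)
    rwa [inv_inv]
  · intro x
    obtain ⟨T', hT', hx⟩ : x ∈ ⋃₀ 𝒯 := h.2.1 ▸ mem_univ x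
    obtain ⟨ρ, -, hρ⟩ := hk T' hT'
    have hbt := h.smap_bt_eq hne hT (hρ.trans (bt_subset hT' k))
    have hag : Agree (σ⁻¹ 0) R 𝒯 (smap ρ⁻¹ 𝒯) := agree_of_bt_eq hne hT h.2.1 hr (by
      rw [bt_smap', inv_inv, ← hbt, smap_inv_smap])
    have hag := hag.smap σ
    rw [show σ (σ⁻¹ 0) = 0 from σ.apply_symm_apply 0, ← smap_mul] at hag
    refine ⟨ρ, ?_, ?_⟩
    · have h1 := hdet _ hag
      rw [mem_symGroup, show ρ * (σ⁻¹ * γ * σ) * ρ⁻¹ = (σ * ρ⁻¹)⁻¹ * (γ * (σ * ρ⁻¹)) by group,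
        smap_mul, smap_mul, h1, smap_inv_smap]
    · refine (dist_apply_le _ x (ρ y)).trans ?_
      have h1 : dist ((ρ * (σ⁻¹ * γ * σ) * ρ⁻¹) (ρ y)) (ρ y) = dist ((σ⁻¹ * γ * σ) y) y := by
        change dist (ρ ((σ⁻¹ * γ * σ) (ρ⁻¹ (ρ y)))) (ρ y) = _
        rw [show ρ⁻¹ (ρ y) = y from ρ.symm_apply_apply y, ρ.dist_eq]
      have h2 : dist x (ρ y) ≤ (k + 1) * D :=
        hdiam.dist_le_of_mem_bt hT' (hρ (tmap_mem_smap.2 (self_mem_bt hne hT _))) hx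
          (mem_image_of_mem ρ hy)
      rw [h1]
      linarith

theorem exists_tRigid_tLocIso (h : IsTiling ⊤ 𝒯) (hlip : TilingLIP ⊤ 𝒯)
    (hdet : ∀ (σ γ : V ≃ᵢ V) (R : ℝ), γ ≠ 1 → ∃ τ : V ≃ᵢ V,
      Agree 0 R (smap σ 𝒯) (smap τ 𝒯) ∧ smap γ (smap τ 𝒯) ≠ smap τ 𝒯) :
    ∃ 𝒯' : Set (Set V), IsTiling ⊤ 𝒯' ∧ TRigid ⊤ 𝒯' ∧ TLocIso ⊤ 𝒯 𝒯' := by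
  obtain ⟨D, hD, hdiam⟩ := h.exists_diamLE
  let F : (V ≃ᵢ V) × ℝ → Set (V ≃ᵢ V) := fun p => {γ | dist (γ 0) 0 ≤ p.2 - 8 * D ∧
    ∀ T ∈ smap p.1 𝒯, Meets 0 (8 * D) T → tmap γ T ∈ smap p.1 𝒯}
  have hstep : ∀ p : (V ≃ᵢ V) × ℝ, ∃ q : (V ≃ᵢ V) × ℝ, p.2 + 1 ≤ q.2 ∧
      Agree 0 p.2 (smap p.1 𝒯) (smap q.1 𝒯) ∧
      ∀ γ ∈ F p, γ ≠ 1 → ∀ B, Agree 0 q.2 (smap q.1 𝒯) B → smap γ B ≠ B := by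
    intro p
    obtain ⟨τ, R', h1, h2, h3⟩ := exists_agree_forall_smap_ne hdet
      ((h.finite_setOf_tmap_mem hdiam hD p.1 (p.2 - 8 * D)).sdiff (t := {1}))
      (fun h => h.2 rfl) p.1 p.2
    exact ⟨(τ, R'), h1, h2, fun γ hγ hne => h3 γ ⟨hγ, hne⟩⟩
  choose next hnext using hstep
  let p : ℕ → (V ≃ᵢ V) × ℝ := fun n => next^[n] (1, 0)
  have hp : ∀ n, p (n + 1) = next (p n) := fun n => Function.iterate_succ_apply' next n _
  have hmono : Monotone fun n => (p n).2 := monotone_nat_of_le_succ fun n => by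
    have := (hnext (p n)).1
    rw [hp]
    linarith
  have hlarge : ∀ n : ℕ, (n : ℝ) ≤ (p n).2 := by
    intro n
    induction n with
    | zero => simp [p]
    | succ n ih =>
      have := (hnext (p n)).1
      rw [hp]
      push_cast
      linarith
  have hag : ∀ m n, m ≤ n → Agree 0 (p m).2 (smap (p m).1 𝒯) (smap (p n).1 𝒯) := by
    intro m n hmn
    induction n, hmn using Nat.le_induction with
    | base => exact fun U _ => Iff.rfl
    | succ n hmn ih =>
      refine ih.trans (Agree.mono (hmono hmn) ?_)
      rw [hp]
      exact (hnext (p n)).2.1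
  let 𝒯' : Set (Set V) := {U | ∃ k, Meets 0 (p k).2 U ∧ U ∈ smap (p k).1 𝒯}
  have hne' : ∅ ∉ 𝒯' := by
    rintro ⟨k, hk, -⟩
    simp [Meets] at hk
  have hlim : ∀ k, Agree 0 (p k).2 (smap (p k).1 𝒯) 𝒯' := by
    refine fun k U hU => ⟨fun h => ⟨k, hU, h⟩, ?_⟩
    rintro ⟨j, hj, hUj⟩
    rcases le_total j k with hjk | hkj
    · exact (hag j k hjk U hj).1 hUj
    · exact (hag k j hkj U hU).2 hUj
  have hall : ∀ R, ∃ σ : V ≃ᵢ V, Agree 0 R (smap σ 𝒯) 𝒯' := by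
    intro R
    obtain ⟨n, hn⟩ := exists_nat_ge R
    exact ⟨_, (hlim n).mono (hn.trans (hlarge n))⟩
  refine ⟨𝒯', isTiling_of_agree h hne' hall, fun γ _ hγ => ?_, tLocIso_of_agree h hlip hne' hall⟩
  by_contra hne1
  obtain ⟨n, hn⟩ := exists_nat_ge (8 * D + dist (γ 0) 0)
  replace hn := hn.trans (hlarge n)
  have hmem : γ ∈ F (p n) := by
    refine ⟨by linarith, fun T hT hm => ?_⟩
    rw [hlim n _ ((hm.tmap_add le_rfl).mono hn), smap_eq_self_iff.1 hγ]
    exact (hlim n T (hm.mono (by linarith [dist_nonneg (x := γ 0) (y := 0)]))).1 hT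
  have hl := hlim (n + 1)
  rw [hp] at hl
  exact (hnext (p n)).2.2 γ hmem hne1 𝒯' hl hγ

/-- A tiling of a euclidean space with the local isomorphism property is locally isomorphic to a
rigid tiling if and only if it has no nontrivial translation. -/
theorem exists_tRigid_tLocIso_iff (h : IsTiling ⊤ 𝒯) (hlip : TilingLIP ⊤ 𝒯) :
    (∃ 𝒯' : Set (Set V), IsTiling ⊤ 𝒯' ∧ TRigid ⊤ 𝒯' ∧ TLocIso ⊤ 𝒯 𝒯') ↔
      ∀ t : V ≃ᵢ V, lin t = 1 → smap t 𝒯 = 𝒯 → t = 1 := by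
  constructor
  · rintro ⟨𝒯', h', hrigid, hloc⟩ t ht hinv
    exact eq_one_of_smap_eq_of_tLocIso_tRigid h h' hlip.empty_notMem hrigid hloc ht hinv
  · intro htr
    refine exists_tRigid_tLocIso h hlip fun σ γ R hγ => ?_
    by_contra! hcon
    obtain ⟨g, hg, hgl, hginv⟩ := exists_translation_of_forall_agree h hlip hγ hcon
    exact hg (htr g hgl hginv)

end Euclidean

/-- **Corollary 4.3.** Let `n ≥ 1` and let `𝒯` be a tiling of the euclidean space `ℝⁿ`
(isomorphism modulo the group of all bijective isometries) which satisfies the local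
isomorphism property. Then `𝒯` is locally isomorphic to a rigid tiling if and only if it is
not invariant through a nontrivial translation. -/
theorem cor_4_3 (n : ℕ) (hn : 1 ≤ n) (𝒯 : Set (Set (EuclideanSpace ℝ (Fin n))))
    (htiling : IsTiling (⊤ : Subgroup (EuclideanSpace ℝ (Fin n) ≃ᵢ EuclideanSpace ℝ (Fin n))) 𝒯)
    (hlip : TilingLIP (⊤ : Subgroup (EuclideanSpace ℝ (Fin n) ≃ᵢ EuclideanSpace ℝ (Fin n))) 𝒯) :
    (∃ 𝒯' : Set (Set (EuclideanSpace ℝ (Fin n))),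
        IsTiling ⊤ 𝒯' ∧ TRigid ⊤ 𝒯' ∧ TLocIso ⊤ 𝒯 𝒯') ↔
      ¬ ∃ v : EuclideanSpace ℝ (Fin n), v ≠ 0 ∧
        (fun T : Set (EuclideanSpace ℝ (Fin n)) => (fun x => x + v) '' T) '' 𝒯 = 𝒯 := by
  rw [exists_tRigid_tLocIso_iff htiling hlip]
  constructor
  · rintro htr ⟨v, hv, hinv⟩
    have h1 : IsometryEquiv.addRight v = 1 := by
      refine htr _ ?_ hinv
      ext1 x
      simp [lin_apply]
    exact hv (by simpa using DFunLike.congr_fun h1 0)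
  · intro hno t ht hinv
    have h1 : ∀ x, t x = x + t 0 := fun x => by
      have := lin_apply t x
      rw [ht, one_apply_eq_self, eq_sub_iff_add_eq] at this
      exact this.symm
    refine eq_one_of_lin_eq_one ht (x := 0) ?_
    by_contra hv
    refine hno ⟨t 0, hv, ?_⟩
    simp only [← h1]
    exact hinv

end Paper
end
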